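/- arXiv:1701.02573 — 6 statements merged into one kernel-verified Lean document; each statement's English description precedes it below -/
import Mathlib

section
/- Let R be a Noetherian commutative ring, W ∈ R, and f : E → F a morphism of matrix factorizations of W over R. If for every prime ideal p of R the base-changed morphism f ⊗ κ(p), a morphism of matrix factorizations of the image of W over the residue field κ(p), is null-homotopic, then there exists an integer n ≥ 1 such that the n-fold tensor power f^{⊗n} : E^{⊗n} → F^{⊗n}, a morphism of matrix factorizations of nW over R, is null-homotopic. -/
open Matrix Kronecker

structure MF (R : Type) [CommRing R] : Type 1 where
  ι1 : Type
  ι0 : Type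
  [fin1 : Fintype ι1]
  [fin0 : Fintype ι0]
  [dec1 : DecidableEq ι1]
  [dec0 : DecidableEq ι0]
  A : Matrix ι0 ι1 R
  B : Matrix ι1 ι0 R

attribute [instance] MF.fin1 MF.fin0 MF.dec1 MF.dec0

namespace MF

variable {R S : Type} [CommRing R] [CommRing S]

def IsMF (w : R) (F : MF R) : Prop :=
  F.B * F.A = w • (1 : Matrix F.ι1 F.ι1 R) ∧ F.A * F.B = w • (1 : Matrix F.ι0 F.ι0 R)

def Contractible (F : MF R) : Prop :=
  ∃ (h0 : Matrix F.ι1 F.ι0 R) (h1 : Matrix F.ι0 F.ι1 R),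
    (1 : Matrix F.ι0 F.ι0 R) = F.A * h0 + h1 * F.B ∧
    (1 : Matrix F.ι1 F.ι1 R) = F.B * h1 + h0 * F.A

def map (f : R →+* S) (F : MF R) : MF S where
  ι1 := F.ι1
  ι0 := F.ι0
  A := F.A.map f
  B := F.B.map f

def Supp (F : MF R) : Set (PrimeSpectrum R) :=
  { p | ¬ Contractible (F.map (algebraMap R (Localization.AtPrime p.asIdeal))) }

/-- The tensor product of two matrix factorizations (of `v` and `w`), a matrix
factorization of `v + w`, with `(E⊗F)₁ = (E₁⊗F₀) ⊕ (E₀⊗F₁)`,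
`(E⊗F)₀ = (E₀⊗F₀) ⊕ (E₁⊗F₁)` and the usual sign conventions. -/
def tensor (E F : MF R) : MF R where
  ι1 := (E.ι1 × F.ι0) ⊕ (E.ι0 × F.ι1)
  ι0 := (E.ι0 × F.ι0) ⊕ (E.ι1 × F.ι1)
  A := Matrix.fromBlocks
        (E.A ⊗ₖ (1 : Matrix F.ι0 F.ι0 R)) ((1 : Matrix E.ι0 E.ι0 R) ⊗ₖ F.A)
        (-((1 : Matrix E.ι1 E.ι1 R) ⊗ₖ F.B)) (E.B ⊗ₖ (1 : Matrix F.ι1 F.ι1 R))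
  B := Matrix.fromBlocks
        (E.B ⊗ₖ (1 : Matrix F.ι0 F.ι0 R)) (-((1 : Matrix E.ι1 E.ι1 R) ⊗ₖ F.A))
        ((1 : Matrix E.ι0 E.ι0 R) ⊗ₖ F.B) (E.A ⊗ₖ (1 : Matrix F.ι1 F.ι1 R))

/-- A morphism of matrix factorizations, given by the two component matrices
`f1 : E₁ → F₁` and `f0 : E₀ → F₀`. -/
structure Hom (E F : MF R) : Type where
  f1 : Matrix F.ι1 E.ι1 R
  f0 : Matrix F.ι0 E.ι0 R

/-- The pair `(f1, f0)` commutes with the structure maps. -/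
def Hom.IsHom {E F : MF R} (f : Hom E F) : Prop :=
  f.f0 * E.A = F.A * f.f1 ∧ f.f1 * E.B = F.B * f.f0

/-- Null-homotopic morphisms of matrix factorizations. -/
def Hom.NullHomotopic {E F : MF R} (f : Hom E F) : Prop :=
  ∃ (h0 : Matrix F.ι1 E.ι0 R) (h1 : Matrix F.ι0 E.ι1 R),
    f.f0 = F.A * h0 + h1 * E.B ∧ f.f1 = F.B * h1 + h0 * E.A

/-- Base change of a morphism of matrix factorizations. -/
def Hom.map (φ : R →+* S) {E F : MF R} (f : Hom E F) : Hom (E.map φ) (F.map φ) where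
  f1 := f.f1.map φ
  f0 := f.f0.map φ

/-- The identity morphism. -/
def Hom.id (F : MF R) : Hom F F where
  f1 := 1
  f0 := 1

/-- Composition of morphisms. -/
def Hom.comp {E F G : MF R} (g : Hom F G) (f : Hom E F) : Hom E G where
  f1 := g.f1 * f.f1
  f0 := g.f0 * f.f0

/-- Two morphisms are homotopic if their difference is null-homotopic. -/
def Hom.Homotopic {E F : MF R} (f g : Hom E F) : Prop :=
  Hom.NullHomotopic (⟨f.f1 - g.f1, f.f0 - g.f0⟩ : Hom E F)

/-- The tensor product of two morphisms of matrix factorizations. -/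
def Hom.tensor {E E' F F' : MF R} (f : Hom E E') (g : Hom F F') :
    Hom (E.tensor F) (E'.tensor F') where
  f1 := Matrix.fromBlocks (f.f1 ⊗ₖ g.f0) 0 0 (f.f0 ⊗ₖ g.f1)
  f0 := Matrix.fromBlocks (f.f0 ⊗ₖ g.f0) 0 0 (f.f1 ⊗ₖ g.f1)

/-- `pow1 E n` is the `(n+1)`-fold tensor power `E^{⊗(n+1)}`. -/
def pow1 (E : MF R) : ℕ → MF R
  | 0 => E
  | n + 1 => (pow1 E n).tensor E

/-- `Hom.pow1 f n` is the `(n+1)`-fold tensor power `f^{⊗(n+1)}` of a morphism. -/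
def Hom.pow1 {E F : MF R} (f : Hom E F) : (n : ℕ) → Hom (E.pow1 n) (F.pow1 n)
  | 0 => f
  | n + 1 => (Hom.pow1 f n).tensor f

end MF

namespace MF

variable {R S : Type} [CommRing R] [CommRing S]

/-- The matrix of `φ₁` on a tensor product, indexed by explicit sums of products. -/
def tensorA (E F : MF R) :
    Matrix ((E.ι0 × F.ι0) ⊕ (E.ι1 × F.ι1)) ((E.ι1 × F.ι0) ⊕ (E.ι0 × F.ι1)) R :=
  fromBlocks (E.A ⊗ₖ 1) (1 ⊗ₖ F.A) (-(1 ⊗ₖ F.B)) (E.B ⊗ₖ 1)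

/-- The matrix of `φ₀` on a tensor product, indexed by explicit sums of products. -/
def tensorB (E F : MF R) :
    Matrix ((E.ι1 × F.ι0) ⊕ (E.ι0 × F.ι1)) ((E.ι0 × F.ι0) ⊕ (E.ι1 × F.ι1)) R :=
  fromBlocks (E.B ⊗ₖ 1) (-(1 ⊗ₖ F.A)) (1 ⊗ₖ F.B) (E.A ⊗ₖ 1)

/-- The odd component of a tensor product of morphisms. -/
def Hom.tensor1 {E E' F F' : MF R} (f : Hom E E') (g : Hom F F') :
    Matrix ((E'.ι1 × F'.ι0) ⊕ (E'.ι0 × F'.ι1)) ((E.ι1 × F.ι0) ⊕ (E.ι0 × F.ι1)) R :=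
  fromBlocks (f.f1 ⊗ₖ g.f0) 0 0 (f.f0 ⊗ₖ g.f1)

/-- The even component of a tensor product of morphisms. -/
def Hom.tensor0 {E E' F F' : MF R} (f : Hom E E') (g : Hom F F') :
    Matrix ((E'.ι0 × F'.ι0) ⊕ (E'.ι1 × F'.ι1)) ((E.ι0 × F.ι0) ⊕ (E.ι1 × F.ι1)) R :=
  fromBlocks (f.f0 ⊗ₖ g.f0) 0 0 (f.f1 ⊗ₖ g.f1)

/-- The tensor product of factorizations of `v` and `w` is a factorization of `v + w`. -/
theorem IsMF.tensor {v w : R} {E F : MF R} (hE : E.IsMF v) (hF : F.IsMF w) :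
    (E.tensor F).IsMF (v + w) := by
  obtain ⟨hE1, hE0⟩ := hE
  obtain ⟨hF1, hF0⟩ := hF
  have hBA : tensorB E F * tensorA E F = (v + w) • 1 := by
    rw [tensorA, tensorB, fromBlocks_multiply, ← fromBlocks_one, fromBlocks_smul]
    simp only [← mul_kronecker_mul, Matrix.mul_neg, Matrix.neg_mul, Matrix.mul_one,
      Matrix.one_mul, hE1, hE0, hF1, hF0, neg_neg, smul_kronecker, kronecker_smul,
      one_kronecker_one, add_neg_cancel, smul_zero, add_smul]
    congr 1; abel
  have hAB : tensorA E F * tensorB E F = (v + w) • 1 := by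
    rw [tensorA, tensorB, fromBlocks_multiply, ← fromBlocks_one, fromBlocks_smul]
    simp only [← mul_kronecker_mul, Matrix.mul_neg, Matrix.neg_mul, Matrix.mul_one,
      Matrix.one_mul, hE1, hE0, hF1, hF0, neg_neg, smul_kronecker, kronecker_smul,
      one_kronecker_one, neg_add_cancel, smul_zero, add_smul]
    congr 1; abel
  exact ⟨hBA, hAB⟩

theorem IsMF.pow1 {w : R} {E : MF R} (hE : E.IsMF w) (n : ℕ) :
    (E.pow1 n).IsMF ((n + 1 : ℕ) • w) := by
  induction n with
  | zero => rw [zero_add, one_nsmul]; exact hE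
  | succ n ih => rw [succ_nsmul]; exact ih.tensor hE

theorem Hom.IsHom.tensor {E E' F F' : MF R} {f : Hom E E'} {g : Hom F F'}
    (hf : f.IsHom) (hg : g.IsHom) : (f.tensor g).IsHom := by
  obtain ⟨hf0, hf1⟩ := hf
  obtain ⟨hg0, hg1⟩ := hg
  have hA : f.tensor0 g * tensorA E F = tensorA E' F' * f.tensor1 g := by
    simp only [tensorA, Hom.tensor0, Hom.tensor1, fromBlocks_multiply, ← mul_kronecker_mul,
      Matrix.mul_neg, Matrix.neg_mul, Matrix.mul_one, Matrix.one_mul, hf0, hf1, hg0, hg1,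
      Matrix.mul_zero, Matrix.zero_mul, neg_zero, add_zero, zero_add]
  have hB : f.tensor1 g * tensorB E F = tensorB E' F' * f.tensor0 g := by
    simp only [tensorB, Hom.tensor0, Hom.tensor1, fromBlocks_multiply, ← mul_kronecker_mul,
      Matrix.mul_neg, Matrix.neg_mul, Matrix.mul_one, Matrix.one_mul, hf0, hf1, hg0, hg1,
      Matrix.mul_zero, Matrix.zero_mul, neg_zero, add_zero, zero_add]
  exact ⟨hA, hB⟩

theorem Hom.IsHom.pow1 {E F : MF R} {f : Hom E F} (hf : f.IsHom) (n : ℕ) :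
    (f.pow1 n).IsHom := by
  induction n with
  | zero => exact hf
  | succ n ih => exact ih.tensor hf

theorem Hom.IsHom.map {E F : MF R} {f : Hom E F} (hf : f.IsHom) (φ : R →+* S) :
    (f.map φ).IsHom := by
  have hA : f.f0.map φ * E.A.map φ = F.A.map φ * f.f1.map φ := by
    rw [← Matrix.map_mul, ← Matrix.map_mul, hf.1]
  have hB : f.f1.map φ * E.B.map φ = F.B.map φ * f.f0.map φ := by
    rw [← Matrix.map_mul, ← Matrix.map_mul, hf.2]
  exact ⟨hA, hB⟩

/-- If `g` is homotopic to `s • v` for a cycle `v`, and `v ⊗ (s • f)` equals `v ⊗ ∂k`, then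
`g ⊗ f` is null-homotopic. -/
theorem Hom.nullHomotopic_tensor {G G' E F : MF R} (g : Hom G G') (f : Hom E F)
    (hf : f.IsHom) (s : R)
    (h0 : Matrix G'.ι1 G.ι0 R) (h1 : Matrix G'.ι0 G.ι1 R) (v : Hom G G') (hv : v.IsHom)
    (hg0 : g.f0 = G'.A * h0 + h1 * G.B + s • v.f0)
    (hg1 : g.f1 = G'.B * h1 + h0 * G.A + s • v.f1)
    (k0 : Matrix F.ι1 E.ι0 R) (k1 : Matrix F.ι0 E.ι1 R)
    (h00 : v.f0 ⊗ₖ (s • f.f0) = v.f0 ⊗ₖ (F.A * k0 + k1 * E.B))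
    (h01 : v.f0 ⊗ₖ (s • f.f1) = v.f0 ⊗ₖ (F.B * k1 + k0 * E.A))
    (h10 : v.f1 ⊗ₖ (s • f.f0) = v.f1 ⊗ₖ (F.A * k0 + k1 * E.B))
    (h11 : v.f1 ⊗ₖ (s • f.f1) = v.f1 ⊗ₖ (F.B * k1 + k0 * E.A)) :
    (g.tensor f).NullHomotopic := by
  obtain ⟨hf0, hf1⟩ := hf
  obtain ⟨hv0, hv1⟩ := hv
  let H0 := fromBlocks (h0 ⊗ₖ f.f0) (-(v.f1 ⊗ₖ k1)) (v.f0 ⊗ₖ k0) (h1 ⊗ₖ f.f1)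
  let H1 := fromBlocks (h1 ⊗ₖ f.f0) (v.f0 ⊗ₖ k1) (-(v.f1 ⊗ₖ k0)) (h0 ⊗ₖ f.f1)
  have e0 : g.tensor0 f = tensorA G' F * H0 + H1 * tensorB G E := by
    simp only [Hom.tensor0, tensorA, tensorB, H0, H1, hg0, hg1, add_kronecker, smul_kronecker]
    simp only [← kronecker_smul, h00, h11]
    simp only [fromBlocks_multiply, fromBlocks_add, ← mul_kronecker_mul,
      Matrix.mul_neg, Matrix.neg_mul, Matrix.mul_one, Matrix.one_mul, hf0, hf1, hv0, hv1,
      kronecker_add]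
    congr 1 <;> abel
  have e1 : g.tensor1 f = tensorB G' F * H1 + H0 * tensorA G E := by
    simp only [Hom.tensor1, tensorA, tensorB, H0, H1, hg0, hg1, add_kronecker, smul_kronecker]
    simp only [← kronecker_smul, h01, h10]
    simp only [fromBlocks_multiply, fromBlocks_add, ← mul_kronecker_mul,
      Matrix.mul_neg, Matrix.neg_mul, Matrix.mul_one, Matrix.one_mul, hf0, hf1, hv0, hv1,
      kronecker_add]
    congr 1 <;> abel
  exact ⟨H0, H1, e0, e1⟩

/-- Null-homotopic modulo an ideal: the morphism differs from a boundary by matrices with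
entries in `I`. -/
def Hom.NullMod (I : Ideal R) {E F : MF R} (f : Hom E F) : Prop :=
  ∃ (h0 : Matrix F.ι1 E.ι0 R) (h1 : Matrix F.ι0 E.ι1 R),
    (∀ i j, (f.f0 - (F.A * h0 + h1 * E.B)) i j ∈ I) ∧
    (∀ i j, (f.f1 - (F.B * h1 + h0 * E.A)) i j ∈ I)

theorem map_mk_eq_iff {m n : Type} (I : Ideal R) (M N : Matrix m n R) :
    M.map (Ideal.Quotient.mk I) = N.map (Ideal.Quotient.mk I) ↔ ∀ i j, (M - N) i j ∈ I := by
  simp [← Matrix.ext_iff, Ideal.Quotient.eq]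

theorem exists_map_mk_eq {m n : Type} (I : Ideal R) (M : Matrix m n (R ⧸ I)) :
    ∃ N : Matrix m n R, N.map (Ideal.Quotient.mk I) = M := by
  choose q hq using fun x => Ideal.Quotient.mk_surjective (I := I) x
  exact ⟨M.map q, by ext i j; simp [hq]⟩

theorem Hom.nullMod_of_map {I : Ideal R} {E F : MF R} {f : Hom E F}
    (h : (f.map (Ideal.Quotient.mk I)).NullHomotopic) : f.NullMod I := by
  obtain ⟨h0, h1, e0, e1⟩ := h
  obtain ⟨h0, rfl⟩ := exists_map_mk_eq (m := F.ι1) (n := E.ι0) I h0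
  obtain ⟨h1, rfl⟩ := exists_map_mk_eq (m := F.ι0) (n := E.ι1) I h1
  refine ⟨h0, h1, (map_mk_eq_iff I _ _).1 ?_, (map_mk_eq_iff I _ _).1 ?_⟩
  · rw [Matrix.map_add _ (map_add _), Matrix.map_mul, Matrix.map_mul]; exact e0
  · rw [Matrix.map_add _ (map_add _), Matrix.map_mul, Matrix.map_mul]; exact e1

theorem Hom.NullMod.mono {I J : Ideal R} (hIJ : I ≤ J) {E F : MF R} {f : Hom E F}
    (h : f.NullMod I) : f.NullMod J := by
  obtain ⟨h0, h1, e0, e1⟩ := h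
  exact ⟨h0, h1, fun i j => hIJ (e0 i j), fun i j => hIJ (e1 i j)⟩

theorem Hom.nullMod_bot {E F : MF R} {f : Hom E F} (h : f.NullMod ⊥) : f.NullHomotopic := by
  obtain ⟨h0, h1, e0, e1⟩ := h
  refine ⟨h0, h1, ?_, ?_⟩
  · ext i j; exact sub_eq_zero.1 (e0 i j)
  · ext i j; exact sub_eq_zero.1 (e1 i j)

theorem map_kronecker {m n p q : Type} (φ : R →+* S) (M : Matrix m n R) (N : Matrix p q R) :
    (M ⊗ₖ N).map φ = M.map φ ⊗ₖ N.map φ := by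
  ext; simp

theorem Hom.nullHomotopic_map_tensor {G G' E F : MF R} {g : Hom G G'} {f : Hom E F}
    (φ : R →+* S) (h : ((g.map φ).tensor (f.map φ)).NullHomotopic) :
    ((g.tensor f).map φ).NullHomotopic := by
  have hA : ∀ X Y : MF R, (tensorA X Y).map φ = tensorA (X.map φ) (Y.map φ) := by
    intro X Y
    have : (tensorA X Y).map φ = fromBlocks (X.A.map φ ⊗ₖ 1) (1 ⊗ₖ Y.A.map φ)
        (-(1 ⊗ₖ Y.B.map φ)) (X.B.map φ ⊗ₖ 1) := by
      simp [tensorA, fromBlocks_map, map_kronecker, Matrix.map_neg]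
    exact this
  have hB : ∀ X Y : MF R, (tensorB X Y).map φ = tensorB (X.map φ) (Y.map φ) := by
    intro X Y
    have : (tensorB X Y).map φ = fromBlocks (X.B.map φ ⊗ₖ 1) (-(1 ⊗ₖ Y.A.map φ))
        (1 ⊗ₖ Y.B.map φ) (X.A.map φ ⊗ₖ 1) := by
      simp [tensorB, fromBlocks_map, map_kronecker, Matrix.map_neg]
    exact this
  have h0 : (g.tensor0 f).map φ = (g.map φ).tensor0 (f.map φ) := by
    have : (g.tensor0 f).map φ = fromBlocks (g.f0.map φ ⊗ₖ f.f0.map φ) 0 0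
        (g.f1.map φ ⊗ₖ f.f1.map φ) := by
      simp [Hom.tensor0, fromBlocks_map, map_kronecker]
    exact this
  have h1 : (g.tensor1 f).map φ = (g.map φ).tensor1 (f.map φ) := by
    have : (g.tensor1 f).map φ = fromBlocks (g.f1.map φ ⊗ₖ f.f0.map φ) 0 0
        (g.f0.map φ ⊗ₖ f.f1.map φ) := by
      simp [Hom.tensor1, fromBlocks_map, map_kronecker]
    exact this
  obtain ⟨H0, H1, e0, e1⟩ := h
  let H0' : Matrix ((G'.ι1 × F.ι0) ⊕ (G'.ι0 × F.ι1)) ((G.ι0 × E.ι0) ⊕ (G.ι1 × E.ι1)) S := H0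
  let H1' : Matrix ((G'.ι0 × F.ι0) ⊕ (G'.ι1 × F.ι1)) ((G.ι1 × E.ι0) ⊕ (G.ι0 × E.ι1)) S := H1
  have e0' : (g.tensor0 f).map φ = (tensorA G' F).map φ * H0' + H1' * (tensorB G E).map φ := by
    rw [h0, hA, hB]
    exact e0
  have e1' : (g.tensor1 f).map φ = (tensorB G' F).map φ * H1' + H0' * (tensorA G E).map φ := by
    rw [h1, hA, hB]
    exact e1
  exact ⟨H0', H1', e0', e1'⟩

/-- In a Noetherian ring the `s`-power torsion is bounded. -/
theorem exists_pow_mul_eq_zero [IsNoetherianRing R] (s : R) :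
    ∃ c : ℕ, ∀ (N : ℕ) (x : R), s ^ N * x = 0 → s ^ c * x = 0 := by
  obtain ⟨c, hc⟩ := monotone_stabilizes_iff_noetherian.2 ‹IsNoetherianRing R›
    (⟨fun n => LinearMap.ker (LinearMap.mulLeft R (s ^ n)), fun a b hab x hx => by
      obtain ⟨d, rfl⟩ := Nat.exists_eq_add_of_le hab
      simp only [LinearMap.mem_ker, LinearMap.mulLeft_apply] at hx ⊢
      rw [pow_add, mul_right_comm, hx, zero_mul]⟩ : ℕ →o Ideal R)
  refine ⟨c, fun N x hx => ?_⟩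
  have h1 : x ∈ LinearMap.ker (LinearMap.mulLeft R (s ^ (c + N))) := by
    simp only [LinearMap.mem_ker, LinearMap.mulLeft_apply, pow_add, mul_assoc, hx, mul_zero]
  have h2 := hc (c + N) (Nat.le_add_right c N)
  change LinearMap.ker _ = LinearMap.ker _ at h2
  rw [← h2] at h1
  simpa using h1

/-- A matrix with entries in `J * (I ⊔ (t))` is, modulo `J * I`, a multiple `t • y` of a matrix
`y` with entries in `J`. -/
theorem exists_eq_smul_of_mem {m n : Type} {I J : Ideal R} {t : R} {u : Matrix m n R}
    (hu : ∀ i j, u i j ∈ J * (I ⊔ Ideal.span {t})) :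
    ∃ y : Matrix m n R, (∀ i j, y i j ∈ J) ∧ ∀ i j, (u - t • y) i j ∈ J * I := by
  have key : ∀ x ∈ J * (I ⊔ Ideal.span {t}), ∃ y ∈ J, x - t * y ∈ J * I := by
    intro x hx
    rw [Ideal.mul_sup, Submodule.mem_sup] at hx
    obtain ⟨a, ha, b, hb, rfl⟩ := hx
    obtain ⟨y, hy, rfl⟩ := Ideal.mem_mul_span_singleton.1 hb
    exact ⟨y, hy, by simpa [mul_comm] using ha⟩
  choose y hy hy' using fun i j => key _ (hu i j)
  exact ⟨Matrix.of y, hy, hy'⟩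

theorem kronecker_map_mk_eq {m n p q : Type} {I J : Ideal R} {v : Matrix m n R}
    {M N : Matrix p q R} (hv : ∀ i j, v i j ∈ J) (hMN : ∀ i j, (M - N) i j ∈ I) :
    v.map (Ideal.Quotient.mk (J * I)) ⊗ₖ M.map (Ideal.Quotient.mk (J * I)) =
      v.map (Ideal.Quotient.mk (J * I)) ⊗ₖ N.map (Ideal.Quotient.mk (J * I)) := by
  ext ⟨i, i'⟩ ⟨j, j'⟩
  simp only [kroneckerMap_apply, Matrix.map_apply, ← map_mul]
  rw [Ideal.Quotient.eq, ← mul_sub]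
  exact Ideal.mul_mem_mul (hv i j) (hMN i' j')

/-- The boundary of any pair of maps is a morphism. -/
theorem isHom_boundary {w : R} {E F : MF R} (hE : E.IsMF w) (hF : F.IsMF w)
    (h0 : Matrix F.ι1 E.ι0 R) (h1 : Matrix F.ι0 E.ι1 R) :
    (⟨F.B * h1 + h0 * E.A, F.A * h0 + h1 * E.B⟩ : Hom E F).IsHom := by
  constructor
  · simp only [Matrix.add_mul, Matrix.mul_add, Matrix.mul_assoc, hE.1]
    simp only [← Matrix.mul_assoc, hF.2]
    simp [add_comm]
  · simp only [Matrix.add_mul, Matrix.mul_add, Matrix.mul_assoc, hE.2]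
    simp only [← Matrix.mul_assoc, hF.1]
    simp [add_comm]

theorem map_smul_ringHom {m n : Type} (φ : R →+* S) (s : R) (M : Matrix m n R) :
    (s • M).map φ = φ s • M.map φ := by
  ext; simp

theorem smul_sub_mem_of_sub_smul_mem {m n p q : Type} [Fintype n] [Fintype p] {L : Ideal R}
    {t : R} {u y : Matrix m n R} {u' y' : Matrix p q R} {M : Matrix n q R} {N : Matrix m p R}
    (huM : u * M = N * u') (hu : ∀ i j, (u - t • y) i j ∈ L)
    (hu' : ∀ i j, (u' - t • y') i j ∈ L) (i : m) (j : q) :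
    t * (y * M - N * y') i j ∈ L := by
  have key : t • (y * M - N * y') = N * (u' - t • y') - (u - t • y) * M := by
    simp only [Matrix.mul_sub, Matrix.sub_mul, huM, smul_sub, Matrix.smul_mul, Matrix.mul_smul]
    abel
  rw [← smul_eq_mul, ← Matrix.smul_apply, key]
  exact L.sub_mem (L.sum_mem fun k _ => L.mul_mem_left _ (hu' k j))
    (L.sum_mem fun k _ => L.mul_mem_right _ (hu i k))

/-- If `s • f` is a boundary modulo `I`, the `s`-power torsion modulo `J * I` is killed by `s ^ c`,
and `g` is null-homotopic modulo `J * (I + (s ^ (c + 1)))`, then `g ⊗ f` is null-homotopic modulo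
`J * I`. -/
theorem Hom.NullMod.tensor {I J : Ideal R} {s : R} {w : R}
    {G G' E F : MF R} (hG : G.IsMF w) (hG' : G'.IsMF w) {g : Hom G G'} (hg : g.IsHom)
    {f : Hom E F} (hf : f.IsHom) {k0 : Matrix F.ι1 E.ι0 R} {k1 : Matrix F.ι0 E.ι1 R}
    (hk0 : ∀ i j, (s • f.f0 - (F.A * k0 + k1 * E.B)) i j ∈ I)
    (hk1 : ∀ i j, (s • f.f1 - (F.B * k1 + k0 * E.A)) i j ∈ I) {c : ℕ}
    (hc : ∀ (N : ℕ) (x : R), s ^ N * x ∈ J * I → s ^ c * x ∈ J * I)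
    (h : g.NullMod (J * (I ⊔ Ideal.span {s ^ (c + 1)}))) :
    (g.tensor f).NullMod (J * I) := by
  obtain ⟨h0, h1, e0, e1⟩ := h
  have hb := isHom_boundary hG hG' h0 h1
  obtain ⟨y0, hy0, ey0⟩ := exists_eq_smul_of_mem e0
  obtain ⟨y1, hy1, ey1⟩ := exists_eq_smul_of_mem e1
  let φ := Ideal.Quotient.mk (J * I)
  let v : Hom G G' := ⟨s ^ c • y1, s ^ c • y0⟩
  have hv0 : ∀ i j, v.f0 i j ∈ J := fun i j => J.mul_mem_left _ (hy0 i j)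
  have hv1 : ∀ i j, v.f1 i j ∈ J := fun i j => J.mul_mem_left _ (hy1 i j)
  have hvA : v.f0.map φ * G.A.map φ = G'.A.map φ * v.f1.map φ := by
    rw [← Matrix.map_mul, ← Matrix.map_mul, map_mk_eq_iff]
    intro i j
    have := hc (c + 1) ((y0 * G.A - G'.A * y1) i j)
      (smul_sub_mem_of_sub_smul_mem (by
        rw [Matrix.sub_mul, Matrix.mul_sub, hg.1]; exact congrArg _ hb.1) ey0 ey1 i j)
    simpa [v, mul_sub] using this
  have hvB : v.f1.map φ * G.B.map φ = G'.B.map φ * v.f0.map φ := by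
    rw [← Matrix.map_mul, ← Matrix.map_mul, map_mk_eq_iff]
    intro i j
    have := hc (c + 1) ((y1 * G.B - G'.B * y0) i j)
      (smul_sub_mem_of_sub_smul_mem (by
        rw [Matrix.sub_mul, Matrix.mul_sub, hg.2]; exact congrArg _ hb.2) ey1 ey0 i j)
    simpa [v, mul_sub] using this
  have hg0 : g.f0.map φ =
      G'.A.map φ * h0.map φ + h1.map φ * G.B.map φ + φ s • v.f0.map φ := by
    rw [← Matrix.map_mul, ← Matrix.map_mul, ← map_smul_ringHom, ← Matrix.map_add _ (map_add φ),
      ← Matrix.map_add _ (map_add φ), map_mk_eq_iff]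
    simpa only [v, smul_smul, ← pow_succ', sub_sub] using ey0
  have hg1 : g.f1.map φ =
      G'.B.map φ * h1.map φ + h0.map φ * G.A.map φ + φ s • v.f1.map φ := by
    rw [← Matrix.map_mul, ← Matrix.map_mul, ← map_smul_ringHom, ← Matrix.map_add _ (map_add φ),
      ← Matrix.map_add _ (map_add φ), map_mk_eq_iff]
    simpa only [v, smul_smul, ← pow_succ', sub_sub] using ey1
  have hK0 : (F.A * k0 + k1 * E.B).map φ = F.A.map φ * k0.map φ + k1.map φ * E.B.map φ := by
    rw [Matrix.map_add _ (map_add φ), Matrix.map_mul, Matrix.map_mul]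
  have hK1 : (F.B * k1 + k0 * E.A).map φ = F.B.map φ * k1.map φ + k0.map φ * E.A.map φ := by
    rw [Matrix.map_add _ (map_add φ), Matrix.map_mul, Matrix.map_mul]
  have hk0' {m n : Type} {y : Matrix m n R} (hy : ∀ i j, y i j ∈ J) :
      y.map φ ⊗ₖ (φ s • f.f0.map φ) =
        y.map φ ⊗ₖ (F.A.map φ * k0.map φ + k1.map φ * E.B.map φ) := by
    rw [← hK0, ← map_smul_ringHom]
    exact kronecker_map_mk_eq hy hk0
  have hk1' {m n : Type} {y : Matrix m n R} (hy : ∀ i j, y i j ∈ J) :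
      y.map φ ⊗ₖ (φ s • f.f1.map φ) =
        y.map φ ⊗ₖ (F.B.map φ * k1.map φ + k0.map φ * E.A.map φ) := by
    rw [← hK1, ← map_smul_ringHom]
    exact kronecker_map_mk_eq hy hk1
  exact nullMod_of_map (nullHomotopic_map_tensor φ
    (nullHomotopic_tensor (g.map φ) (f.map φ) (hf.map φ) (φ s) (h0.map φ) (h1.map φ)
      (v.map φ) ⟨hvA, hvB⟩ hg0 hg1 (k0.map φ) (k1.map φ)
      (hk0' hv0) (hk1' hv0) (hk0' hv1) (hk1' hv1)))

/-- Null-homotopy over the residue field at `p` gives, after clearing denominators,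
a null-homotopy of a multiple `s • f` modulo `p` with `s ∉ p`. -/
theorem Hom.exists_smul_nullMod {E F : MF R} {f : Hom E F} (p : PrimeSpectrum R)
    (h : (f.map ((IsLocalRing.residue (Localization.AtPrime p.asIdeal)).comp
        (algebraMap R (Localization.AtPrime p.asIdeal)))).NullHomotopic) :
    ∃ s ∉ p.asIdeal, (⟨s • f.f1, s • f.f0⟩ : Hom E F).NullMod p.asIdeal := by
  let φ := algebraMap R p.asIdeal.ResidueField
  obtain ⟨h0, h1, e0, e1⟩ : ∃ (h0 : Matrix F.ι1 E.ι0 p.asIdeal.ResidueField)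
      (h1 : Matrix F.ι0 E.ι1 p.asIdeal.ResidueField),
      f.f0.map φ = F.A.map φ * h0 + h1 * E.B.map φ ∧
      f.f1.map φ = F.B.map φ * h1 + h0 * E.A.map φ := h
  obtain ⟨⟨b, hb⟩, hint⟩ := IsLocalization.exist_integer_multiples_of_finite
    (nonZeroDivisors (R ⧸ p.asIdeal))
    (Sum.elim (fun x : F.ι1 × E.ι0 => h0 x.1 x.2) (fun x : F.ι0 × E.ι1 => h1 x.1 x.2))
  obtain ⟨s, rfl⟩ := Ideal.Quotient.mk_surjective b
  have hlift : ∀ x, ∃ r : R, φ r = φ s * Sum.elim (fun x : F.ι1 × E.ι0 => h0 x.1 x.2)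
      (fun x : F.ι0 × E.ι1 => h1 x.1 x.2) x := by
    intro x
    obtain ⟨r, hr⟩ := hint x
    obtain ⟨r, rfl⟩ := Ideal.Quotient.mk_surjective r
    exact ⟨r, hr.trans (Algebra.smul_def _ _)⟩
  choose r hr using hlift
  let k0 : Matrix F.ι1 E.ι0 R := Matrix.of fun i j => r (Sum.inl (i, j))
  let k1 : Matrix F.ι0 E.ι1 R := Matrix.of fun i j => r (Sum.inr (i, j))
  have hk0 : k0.map φ = φ s • h0 := by ext i j; exact hr (Sum.inl (i, j))
  have hk1 : k1.map φ = φ s • h1 := by ext i j; exact hr (Sum.inr (i, j))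
  have hmem {m n : Type} {M N : Matrix m n R} (hMN : M.map φ = N.map φ) (i : m) (j : n) :
      (M - N) i j ∈ p.asIdeal := by
    rw [← Ideal.algebraMap_residueField_eq_zero, Matrix.sub_apply, map_sub, sub_eq_zero]
    exact congrFun (congrFun hMN i) j
  refine ⟨s, fun hs => nonZeroDivisors.ne_zero hb (Ideal.Quotient.eq_zero_iff_mem.2 hs),
    k0, k1, hmem ?_, hmem ?_⟩
  · rw [map_smul_ringHom, Matrix.map_add _ (map_add φ), Matrix.map_mul, Matrix.map_mul, hk0, hk1,
      e0, smul_add, Matrix.smul_mul, Matrix.mul_smul]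
  · rw [map_smul_ringHom, Matrix.map_add _ (map_add φ), Matrix.map_mul, Matrix.map_mul, hk0, hk1,
      e1, smul_add, Matrix.smul_mul, Matrix.mul_smul]

end MF

theorem stmt10 (R : Type) [CommRing R] [IsNoetherianRing R] (W : R)
    (E F : MF R) (hE : E.IsMF W) (hF : F.IsMF W)
    (f : MF.Hom E F) (hf : f.IsHom)
    (h : ∀ p : PrimeSpectrum R,
      (f.map ((IsLocalRing.residue (Localization.AtPrime p.asIdeal)).comp
        (algebraMap R (Localization.AtPrime p.asIdeal)))).NullHomotopic) :
    ∃ n : ℕ, (f.pow1 n).NullHomotopic := by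
  have key : ∀ I : Ideal R, ∀ (J : Ideal R) (n : ℕ), (f.pow1 n).NullMod J →
      ∃ m, (f.pow1 m).NullMod (J * I) := by
    intro I
    induction I using WellFoundedGT.induction with | ind I ih
    intro J n hn
    by_cases hI : I = ⊤
    · exact ⟨n, by simpa [hI] using hn⟩
    by_cases hp : I.IsPrime
    · obtain ⟨s, hs, k0, k1, hk0, hk1⟩ := MF.Hom.exists_smul_nullMod ⟨I, hp⟩ (h ⟨I, hp⟩)
      obtain ⟨c, hc⟩ := MF.exists_pow_mul_eq_zero (Ideal.Quotient.mk (J * I) s)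
      have hlt : I < I ⊔ Ideal.span {s ^ (c + 1)} := by
        refine lt_of_le_of_ne le_sup_left fun heq => hs ?_
        refine hp.mem_of_pow_mem (c + 1) ?_
        rw [heq]
        exact Ideal.mem_sup_right (Ideal.mem_span_singleton_self _)
      obtain ⟨m, hm⟩ := ih _ hlt J n hn
      refine ⟨m + 1, MF.Hom.NullMod.tensor (hE.pow1 m) (hF.pow1 m) (hf.pow1 m) hf
        hk0 hk1 (c := c) (fun N x hx => ?_) hm⟩
      have := hc N (Ideal.Quotient.mk (J * I) x)
      simp only [← map_pow, ← map_mul, Ideal.Quotient.eq_zero_iff_mem] at this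
      exact this hx
    · obtain ⟨a, ha, b, hb, hab⟩ : ∃ a ∉ I, ∃ b ∉ I, a * b ∈ I := by
        by_contra! hcon
        refine hp ⟨hI, fun {x y} hxy => ?_⟩
        by_contra! hxy'
        exact hcon x hxy'.1 y hxy'.2 hxy
      have hlt : ∀ x ∉ I, I < I ⊔ Ideal.span {x} := fun x hx =>
        lt_of_le_of_ne le_sup_left fun heq => hx <| by
          rw [heq]
          exact Ideal.mem_sup_right (Ideal.mem_span_singleton_self _)
      obtain ⟨m, hm⟩ := ih _ (hlt a ha) J n hn
      obtain ⟨l, hl⟩ := ih _ (hlt b hb) _ m hm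
      refine ⟨l, hl.mono ?_⟩
      rw [mul_assoc]
      refine Ideal.mul_mono_right ?_
      rw [Ideal.sup_mul, Ideal.mul_sup, Ideal.mul_sup, Ideal.span_singleton_mul_span_singleton]
      refine sup_le (sup_le Ideal.mul_le_left Ideal.mul_le_left) (sup_le Ideal.mul_le_right ?_)
      exact (Ideal.span_singleton_le_iff_mem _).2 hab
  obtain ⟨m, hm⟩ := key ⊥ ⊤ 0 ⟨0, 0, by simp, by simp⟩
  exact ⟨m, MF.Hom.nullMod_bot (by simpa using hm)⟩
end

section
/- Let R be a Noetherian commutative ring, W ∈ R, let a : E → F be a morphism of matrix factorizations of 0 over R, and let G be a matrix factorization of W over R. If for every prime p ∈ Supp(G) the base-changed morphism a ⊗ κ(p) is null-homotopic, then there exists an integer n ≥ 1 such that G ⊗ a^{⊗n} : G ⊗ E^{⊗n} → G ⊗ F^{⊗n}, a morphism of matrix factorizations of W over R, is null-homotopic. -/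
open Matrix Kronecker

/-- A free `ℤ/2`-graded module with a chosen homogeneous basis and an endomorphism `D`. -/
structure SuperObj (R : Type) [CommRing R] : Type 1 where
  ι : Type
  [fin : Fintype ι]
  [dec : DecidableEq ι]
  par : ι → Bool
  D : Matrix ι ι R

attribute [instance] SuperObj.fin SuperObj.dec

/-- All entries of a matrix lie in the ideal `I`. -/
def EntriesIn {R m n : Type} [CommRing R] (I : Ideal R) (M : Matrix m n R) : Prop :=
  ∀ i j, M i j ∈ I

lemma sub_kronecker {R l m n k : Type} [CommRing R] (M M' : Matrix l m R) (N : Matrix n k R) :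
    (M - M') ⊗ₖ N = M ⊗ₖ N - M' ⊗ₖ N := by
  ext i j
  simp [sub_mul]

lemma kronecker_sub {R l m n k : Type} [CommRing R] (M : Matrix l m R) (N N' : Matrix n k R) :
    M ⊗ₖ (N - N') = M ⊗ₖ N - M ⊗ₖ N' := by
  ext i j
  simp [mul_sub]

namespace EntriesIn

variable {R l m n k : Type} [CommRing R] {I J : Ideal R}

lemma add {M N : Matrix m n R} (hM : EntriesIn I M) (hN : EntriesIn I N) :
    EntriesIn I (M + N) := fun i j => I.add_mem (hM i j) (hN i j)

lemma sub {M N : Matrix m n R} (hM : EntriesIn I M) (hN : EntriesIn I N) :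
    EntriesIn I (M - N) := fun i j => I.sub_mem (hM i j) (hN i j)

lemma mul_left [Fintype m] (N : Matrix l m R) {M : Matrix m n R} (hM : EntriesIn I M) :
    EntriesIn I (N * M) := fun i j => by
  rw [Matrix.mul_apply]
  exact I.sum_mem fun c _ => I.mul_mem_left _ (hM c j)

lemma mul_right [Fintype m] {M : Matrix l m R} (N : Matrix m n R) (hM : EntriesIn I M) :
    EntriesIn I (M * N) := fun i j => by
  rw [Matrix.mul_apply]
  exact I.sum_mem fun c _ => I.mul_mem_right _ (hM i c)

lemma mul_mul [Fintype m] {M : Matrix l m R} {N : Matrix m n R}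
    (hM : EntriesIn I M) (hN : EntriesIn J N) : EntriesIn (I * J) (M * N) := fun i j => by
  rw [Matrix.mul_apply]
  exact Ideal.sum_mem _ fun c _ => Ideal.mul_mem_mul (hM i c) (hN c j)

lemma kron_left {M : Matrix l m R} (N : Matrix n k R) (hM : EntriesIn I M) :
    EntriesIn I (M ⊗ₖ N) := fun i j => I.mul_mem_right _ (hM i.1 j.1)

lemma kron_right (M : Matrix l m R) {N : Matrix n k R} (hN : EntriesIn I N) :
    EntriesIn I (M ⊗ₖ N) := fun i j => I.mul_mem_left _ (hN i.2 j.2)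

lemma mono (hIJ : I ≤ J) {M : Matrix m n R} (hM : EntriesIn I M) : EntriesIn J M :=
  fun i j => hIJ (hM i j)

lemma of_smul {p : Ideal R} [hp : p.IsPrime] {s : R} (hs : s ∉ p) {M : Matrix m n R}
    (hM : EntriesIn p (s • M)) : EntriesIn p M :=
  fun i j => (hp.mem_or_mem (hM i j)).resolve_left hs

/-- Splitting off an `s`-multiple, supported where `M` is. -/
lemma exists_smul_add {s : R} {M : Matrix m n R} (hM : EntriesIn (I ⊔ Ideal.span {s}) M) :
    ∃ b e : Matrix m n R, M = s • b + e ∧ EntriesIn I e ∧ ∀ i j, M i j = 0 → b i j = 0 := by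
  have key : ∀ i j, ∃ b : R, M i j - s * b ∈ I ∧ (M i j = 0 → b = 0) := by
    intro i j
    by_cases h0 : M i j = 0
    · exact ⟨0, by simp [h0], fun _ => rfl⟩
    · obtain ⟨e, he, t, ht, het⟩ := Submodule.mem_sup.1 (hM i j)
      obtain ⟨c, rfl⟩ := Ideal.mem_span_singleton'.1 ht
      refine ⟨c, ?_, fun h => absurd h h0⟩
      rw [← het, mul_comm s c, add_sub_cancel_right]
      exact he
  choose b hb hb0 using key
  refine ⟨.of b, M - s • .of b, by abel, fun i j => ?_, hb0⟩
  simpa using hb i j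

end EntriesIn

namespace SuperObj

variable {R : Type} [CommRing R]

/-- The grading involution. -/
def sgn (X : SuperObj R) : Matrix X.ι X.ι R :=
  Matrix.diagonal fun i => if X.par i then -1 else 1

/-- The matrix preserves parity. -/
def IsEven (X Y : SuperObj R) (f : Matrix Y.ι X.ι R) : Prop :=
  ∀ i j, Y.par i ≠ X.par j → f i j = 0

/-- The matrix reverses parity. -/
def IsOdd (X Y : SuperObj R) (f : Matrix Y.ι X.ι R) : Prop :=
  ∀ i j, Y.par i = X.par j → f i j = 0

/-- `X` is a matrix factorization of `w`. -/
def IsFact (w : R) (X : SuperObj R) : Prop :=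
  IsOdd X X X.D ∧ X.D * X.D = w • (1 : Matrix X.ι X.ι R)

/-- `f` is an even map commuting with the differentials. -/
def IsMor (X Y : SuperObj R) (f : Matrix Y.ι X.ι R) : Prop :=
  IsEven X Y f ∧ Y.D * f = f * X.D

/-- The boundary of an odd map. -/
def bd (X Y : SuperObj R) (h : Matrix Y.ι X.ι R) : Matrix Y.ι X.ι R :=
  Y.D * h + h * X.D

/-- `f` is homotopic to a map with entries in `I`. -/
def Red (I : Ideal R) (X Y : SuperObj R) (f : Matrix Y.ι X.ι R) : Prop :=
  ∃ h, IsOdd X Y h ∧ EntriesIn I (f - bd X Y h)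

/-- The tensor product, with the Koszul sign rule. -/
abbrev tens (X Y : SuperObj R) : SuperObj R where
  ι := X.ι × Y.ι
  par := fun i => xor (X.par i.1) (Y.par i.2)
  D := X.D ⊗ₖ 1 + X.sgn ⊗ₖ Y.D

/-- `f ⊗ a ⊗ ⋯ ⊗ a` (with `n` factors `a`) is homotopic to a map with entries in `I`. -/
def RedPow {E F : SuperObj R} (a : Matrix F.ι E.ι R) (I : Ideal R) :
    ℕ → (X Y : SuperObj R) → Matrix Y.ι X.ι R → Prop
  | 0, X, Y, f => Red I X Y f
  | n + 1, X, Y, f => RedPow a I n (X.tens E) (Y.tens F) (f ⊗ₖ a)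

variable {X Y Z E F : SuperObj R}

lemma sgn_mul_sgn (X : SuperObj R) : X.sgn * X.sgn = 1 := by
  rw [sgn, Matrix.diagonal_mul_diagonal, ← Matrix.diagonal_one]
  congr 1
  ext i
  split_ifs <;> simp

lemma isEven_one (X : SuperObj R) : IsEven X X (1 : Matrix X.ι X.ι R) := fun i j h =>
  Matrix.one_apply_ne fun hij => h (by rw [hij])

lemma isEven_sgn (X : SuperObj R) : IsEven X X X.sgn := fun i j h =>
  Matrix.diagonal_apply_ne _ fun hij => h (by rw [hij])

lemma IsEven.sgn_mul {f : Matrix Y.ι X.ι R} (hf : IsEven X Y f) : Y.sgn * f = f * X.sgn := by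
  ext i j
  rw [sgn, sgn, Matrix.diagonal_mul, Matrix.mul_diagonal]
  by_cases h : Y.par i = X.par j
  · rw [h, mul_comm]
  · simp [hf i j h]

lemma IsOdd.sgn_mul {f : Matrix Y.ι X.ι R} (hf : IsOdd X Y f) : Y.sgn * f = -(f * X.sgn) := by
  ext i j
  rw [sgn, sgn, Matrix.neg_apply, Matrix.diagonal_mul, Matrix.mul_diagonal]
  by_cases h : Y.par i = X.par j
  · simp [hf i j h]
  · cases hi : Y.par i <;> cases hj : X.par j <;> simp_all

lemma IsEven.mul {g : Matrix Z.ι Y.ι R} {f : Matrix Y.ι X.ι R} (hg : IsEven Y Z g)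
    (hf : IsEven X Y f) : IsEven X Z (g * f) := fun i j h => by
  rw [Matrix.mul_apply]
  refine Finset.sum_eq_zero fun c _ => ?_
  by_cases hc : Z.par i = Y.par c
  · rw [hf c j (hc ▸ h), mul_zero]
  · rw [hg i c hc, zero_mul]

lemma IsOdd.mul_even {g : Matrix Z.ι Y.ι R} {f : Matrix Y.ι X.ι R} (hg : IsOdd Y Z g)
    (hf : IsEven X Y f) : IsOdd X Z (g * f) := fun i j h => by
  rw [Matrix.mul_apply]
  refine Finset.sum_eq_zero fun c _ => ?_
  by_cases hc : Z.par i = Y.par c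
  · rw [hg i c hc, zero_mul]
  · rw [hf c j fun h' => hc (h.trans h'.symm), mul_zero]

lemma IsOdd.mul {g : Matrix Z.ι Y.ι R} {f : Matrix Y.ι X.ι R} (hg : IsOdd Y Z g)
    (hf : IsOdd X Y f) : IsEven X Z (g * f) := fun i j h => by
  rw [Matrix.mul_apply]
  refine Finset.sum_eq_zero fun c _ => ?_
  by_cases hc : Z.par i = Y.par c
  · rw [hg i c hc, zero_mul]
  · rw [hf c j ?_, mul_zero]
    cases hi : Z.par i <;> cases hj : Y.par c <;> cases hk : X.par j <;> simp_all

lemma IsEven.kron {f : Matrix Y.ι X.ι R} {g : Matrix F.ι E.ι R} (hf : IsEven X Y f)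
    (hg : IsEven E F g) : IsEven (X.tens E) (Y.tens F) (f ⊗ₖ g) := fun i j h => by
  rw [Matrix.kronecker_apply]
  by_cases h1 : Y.par i.1 = X.par j.1
  · rw [hg i.2 j.2 fun h2 => h (by simp [h1, h2]), mul_zero]
  · rw [hf _ _ h1, zero_mul]

lemma IsOdd.kron_even {f : Matrix Y.ι X.ι R} {g : Matrix F.ι E.ι R} (hf : IsOdd X Y f)
    (hg : IsEven E F g) : IsOdd (X.tens E) (Y.tens F) (f ⊗ₖ g) := fun i j h => by
  rw [Matrix.kronecker_apply]
  by_cases h1 : Y.par i.1 = X.par j.1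
  · rw [hf _ _ h1, zero_mul]
  · rw [hg i.2 j.2 fun h2 => h1 (by simpa [h2] using h), mul_zero]

lemma IsEven.kron_odd {f : Matrix Y.ι X.ι R} {g : Matrix F.ι E.ι R} (hf : IsEven X Y f)
    (hg : IsOdd E F g) : IsOdd (X.tens E) (Y.tens F) (f ⊗ₖ g) := fun i j h => by
  rw [Matrix.kronecker_apply]
  by_cases h1 : Y.par i.1 = X.par j.1
  · rw [hg i.2 j.2 (by simpa [h1] using h), mul_zero]
  · rw [hf _ _ h1, zero_mul]

lemma IsEven.sub {f g : Matrix Y.ι X.ι R} (hf : IsEven X Y f) (hg : IsEven X Y g) :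
    IsEven X Y (f - g) := fun i j h => by rw [Matrix.sub_apply, hf i j h, hg i j h, sub_zero]

lemma IsEven.add {f g : Matrix Y.ι X.ι R} (hf : IsEven X Y f) (hg : IsEven X Y g) :
    IsEven X Y (f + g) := fun i j h => by rw [Matrix.add_apply, hf i j h, hg i j h, add_zero]

lemma IsOdd.add {f g : Matrix Y.ι X.ι R} (hf : IsOdd X Y f) (hg : IsOdd X Y g) :
    IsOdd X Y (f + g) := fun i j h => by rw [Matrix.add_apply, hf i j h, hg i j h, add_zero]

lemma isOdd_zero : IsOdd X Y 0 := fun _ _ _ => rfl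

lemma bd_add (h h' : Matrix Y.ι X.ι R) : bd X Y (h + h') = bd X Y h + bd X Y h' := by
  simp only [bd, Matrix.mul_add, Matrix.add_mul]
  abel

lemma IsFact.tens {w : R} (hX : IsFact w X) (hE : IsFact 0 E) : IsFact w (X.tens E) := by
  refine ⟨(hX.1.kron_even (isEven_one E)).add ((isEven_sgn X).kron_odd hE.1), ?_⟩
  have h := hX.1.sgn_mul
  simp only [Matrix.mul_add, Matrix.add_mul, ← Matrix.mul_kronecker_mul, hX.2, hE.2, h,
    sgn_mul_sgn, Matrix.mul_one, Matrix.one_mul, zero_smul, Matrix.kronecker_zero,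
    Matrix.smul_kronecker, Matrix.one_kronecker_one]
  ext i j
  simp

lemma isMor_one (X : SuperObj R) : IsMor X X 1 := ⟨isEven_one X, by simp⟩

lemma IsMor.kron {f : Matrix Y.ι X.ι R} {a : Matrix F.ι E.ι R} (hf : IsMor X Y f)
    (ha : IsMor E F a) : IsMor (X.tens E) (Y.tens F) (f ⊗ₖ a) := by
  refine ⟨hf.1.kron ha.1, ?_⟩
  simp only [Matrix.mul_add, Matrix.add_mul, ← Matrix.mul_kronecker_mul, hf.2, ha.2,
    hf.1.sgn_mul, Matrix.mul_one, Matrix.one_mul]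

lemma IsMor.sub_bd {w : R} (hX : IsFact w X) (hY : IsFact w Y) {f h : Matrix Y.ι X.ι R}
    (hf : IsMor X Y f) (hh : IsOdd X Y h) : IsMor X Y (f - bd X Y h) := by
  refine ⟨hf.1.sub ((hY.1.mul hh).add (hh.mul hX.1)), ?_⟩
  simp only [bd, Matrix.mul_add, Matrix.add_mul, Matrix.mul_sub, Matrix.sub_mul, hf.2]
  rw [← Matrix.mul_assoc Y.D Y.D, hY.2, Matrix.mul_assoc h, hX.2]
  simp [Matrix.mul_assoc, add_comm]

lemma bd_kron {h : Matrix Y.ι X.ι R} {a : Matrix F.ι E.ι R} (hh : IsOdd X Y h)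
    (ha : IsMor E F a) : bd (X.tens E) (Y.tens F) (h ⊗ₖ a) = bd X Y h ⊗ₖ a := by
  simp only [bd, Matrix.mul_add, Matrix.add_mul, ← Matrix.mul_kronecker_mul, ha.2,
    hh.sgn_mul, Matrix.mul_one, Matrix.one_mul, Matrix.add_kronecker]
  ext i j
  simp
  ring

lemma bd_sgn_mul_kron {b : Matrix Y.ι X.ι R} {h : Matrix F.ι E.ι R} (hY : IsOdd Y Y Y.D)
    (hb : IsEven X Y b) :
    bd (X.tens E) (Y.tens F) ((Y.sgn * b) ⊗ₖ h) =
      b ⊗ₖ bd E F h + (Y.sgn * (b * X.D - Y.D * b)) ⊗ₖ h := by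
  have h1 : Y.sgn * (Y.sgn * b) = b := by rw [← Matrix.mul_assoc, sgn_mul_sgn, Matrix.one_mul]
  have h2 : Y.sgn * b * X.sgn = b := by rw [Matrix.mul_assoc, ← hb.sgn_mul, h1]
  have h3 : Y.D * (Y.sgn * b) = - (Y.sgn * (Y.D * b)) := by
    rw [← Matrix.mul_assoc, ← Matrix.mul_assoc, hY.sgn_mul, Matrix.neg_mul, neg_neg]
  simp only [bd, Matrix.mul_add, Matrix.add_mul, ← Matrix.mul_kronecker_mul, h1, h2, h3,
    Matrix.mul_one, Matrix.one_mul, Matrix.mul_sub, Matrix.mul_assoc Y.sgn b X.D]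
  ext i j
  simp
  ring

lemma Red.of_entriesIn {I : Ideal R} {f : Matrix Y.ι X.ι R} (hf : EntriesIn I f) :
    Red I X Y f := ⟨0, isOdd_zero, by simpa [bd] using hf⟩

lemma Red.mono {I J : Ideal R} (hIJ : I ≤ J) {f : Matrix Y.ι X.ι R} (hf : Red I X Y f) :
    Red J X Y f := let ⟨h, hh, he⟩ := hf; ⟨h, hh, he.mono hIJ⟩

lemma Red.of_homotopic {I : Ideal R} {f g h : Matrix Y.ι X.ι R} (hh : IsOdd X Y h)
    (hfg : EntriesIn I (f - g - bd X Y h)) (hg : Red I X Y g) : Red I X Y f := by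
  obtain ⟨k, hk, he⟩ := hg
  refine ⟨h + k, hh.add hk, ?_⟩
  have : f - bd X Y (h + k) = (f - g - bd X Y h) + (g - bd X Y k) := by
    rw [bd_add]; abel
  rw [this]
  exact hfg.add he

lemma Red.kron {I : Ideal R} {f : Matrix Y.ι X.ι R} {a : Matrix F.ι E.ι R}
    (ha : IsMor E F a) (hf : Red I X Y f) : Red I (X.tens E) (Y.tens F) (f ⊗ₖ a) := by
  obtain ⟨h, hh, he⟩ := hf
  refine ⟨h ⊗ₖ a, hh.kron_even ha.1, ?_⟩
  rw [bd_kron hh ha, ← sub_kronecker]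
  exact he.kron_left a

namespace RedPow

variable {a : Matrix F.ι E.ι R} {I J K : Ideal R}

lemma mono (hIJ : I ≤ J) : ∀ (n : ℕ) {X Y : SuperObj R} {f : Matrix Y.ι X.ι R},
    RedPow a I n X Y f → RedPow a J n X Y f
  | 0, _, _, _, h => Red.mono hIJ h
  | n + 1, _, _, _, h => mono hIJ n h

lemma of_homotopic (ha : IsMor E F a) : ∀ (n : ℕ) {X Y : SuperObj R} {f h : Matrix Y.ι X.ι R},
    IsOdd X Y h → RedPow a I n X Y (f - bd X Y h) → RedPow a I n X Y f
  | 0, _, _, f, h, hh, H => Red.of_homotopic hh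
      (by rw [sub_sub_cancel, sub_self]; exact fun _ _ => I.zero_mem) H
  | n + 1, _, _, f, h, hh, H => of_homotopic ha n (hh.kron_even ha.1) (by
      rw [bd_kron hh ha, ← sub_kronecker]; exact H)

lemma succ (ha : IsMor E F a) : ∀ (n : ℕ) {X Y : SuperObj R} {f : Matrix Y.ι X.ι R},
    RedPow a I n X Y f → RedPow a I (n + 1) X Y f
  | 0, _, _, _, h => Red.kron ha h
  | n + 1, _, _, _, h => succ ha n h

lemma comp : ∀ (n : ℕ) {X Y Z : SuperObj R}
    {g : Matrix Z.ι Y.ι R} {f : Matrix Y.ι X.ι R}, IsMor X Y f → EntriesIn J f →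
    RedPow a K n Y Z g → RedPow a (K * J) n X Z (g * f)
  | 0, X, Y, Z, g, f, hf, hJ, ⟨h, hh, he⟩ => by
      refine ⟨h * f, hh.mul_even hf.1, ?_⟩
      have : g * f - bd X Z (h * f) = (g - bd Y Z h) * f := by
        simp only [bd, Matrix.sub_mul, Matrix.add_mul, Matrix.mul_assoc, hf.2]
      rw [this]
      exact he.mul_mul hJ
  | n + 1, X, Y, Z, g, f, hf, hJ, H => by
      have := comp n (hf.kron (isMor_one E)) (hJ.kron_left 1) H
      rw [← Matrix.mul_kronecker_mul, Matrix.mul_one] at this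
      exact this

end RedPow

/-- Every scalar that is null-homotopic on `G` modulo some ideal is so on `Y`. -/
def Dominates (G Y : SuperObj R) : Prop :=
  ∀ (I : Ideal R) (s : R), Red I G G (s • 1) → Red I Y Y (s • 1)

lemma Dominates.tens {G : SuperObj R} (h : Dominates G Y) (F : SuperObj R) :
    Dominates G (Y.tens F) := fun I s hs => by
  have := (h I s hs).kron (isMor_one F)
  rwa [Matrix.smul_kronecker, Matrix.one_kronecker_one] at this

namespace RedPow

variable {a : Matrix F.ι E.ι R} {J K : Ideal R} {w : R} {G : SuperObj R}

lemma add (hE : IsFact 0 E) (hF : IsFact 0 F) (ha : IsMor E F a) (m : ℕ)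
    (hm : ∀ Y : SuperObj R, IsFact w Y → Dominates G Y → RedPow a K m Y Y 1) :
    ∀ (n : ℕ) {X Y : SuperObj R} {f : Matrix Y.ι X.ι R}, IsFact w X → IsFact w Y →
      Dominates G Y → IsMor X Y f → RedPow a J n X Y f → RedPow a (K * J) (n + m) X Y f
  | 0, X, Y, f, hX, hY, hG, hf, ⟨h, hh, he⟩ => by
      rw [Nat.zero_add]
      refine of_homotopic ha m hh ?_
      have := comp m (hf.sub_bd hX hY hh) he (hm Y hY hG)
      rwa [Matrix.one_mul] at this
  | n + 1, X, Y, f, hX, hY, hG, hf, H => by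
      rw [Nat.add_right_comm]
      exact add hE hF ha m hm n (hX.tens hE) (hY.tens hF) (hG.tens F) (hf.kron ha) H

end RedPow

section Prime

variable {p : Ideal R} [p.IsPrime] {s : R} {w : R} {a : Matrix F.ι E.ι R}

/-- A morphism with entries in `p + (s)` is `s` times an even map which is closed modulo `p`. -/
lemma IsMor.exists_smul_add (hs : s ∉ p) {r : Matrix Y.ι X.ι R} (hr : IsMor X Y r)
    (hI : EntriesIn (p ⊔ Ideal.span {s}) r) :
    ∃ b e : Matrix Y.ι X.ι R, r = s • b + e ∧ IsEven X Y b ∧ EntriesIn p e ∧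
      EntriesIn p (b * X.D - Y.D * b) := by
  obtain ⟨b, e, hrbe, he, hb⟩ := hI.exists_smul_add
  refine ⟨b, e, hrbe, fun i j h => hb i j (hr.1 i j h), he, .of_smul hs ?_⟩
  have : s • (b * X.D - Y.D * b) = Y.D * e - e * X.D := by
    have h2 := hr.2
    rw [hrbe, Matrix.mul_add, Matrix.add_mul, Matrix.mul_smul, Matrix.smul_mul] at h2
    rw [smul_sub, sub_eq_sub_iff_add_eq_add, ← h2, add_comm]
  rw [this]
  exact (he.mul_left _).sub (he.mul_right _)

lemma IsMor.red_kron (hs : s ∉ p) {r : Matrix Y.ι X.ι R} (hY : IsOdd Y Y Y.D)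
    (hr : IsMor X Y r) (hI : EntriesIn (p ⊔ Ideal.span {s}) r) (hsa : Red p E F (s • a)) :
    Red p (X.tens E) (Y.tens F) (r ⊗ₖ a) := by
  obtain ⟨b, e, rfl, hb, he, hbc⟩ := hr.exists_smul_add hs hI
  obtain ⟨h, hh, hae⟩ := hsa
  refine ⟨(Y.sgn * b) ⊗ₖ h, ((isEven_sgn Y).mul hb).kron_odd hh, ?_⟩
  have : (s • b + e) ⊗ₖ a - bd (X.tens E) (Y.tens F) ((Y.sgn * b) ⊗ₖ h) =
      b ⊗ₖ (s • a - bd E F h) + e ⊗ₖ a - (Y.sgn * (b * X.D - Y.D * b)) ⊗ₖ h := by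
    rw [bd_sgn_mul_kron hY hb, kronecker_sub, Matrix.add_kronecker,
      Matrix.smul_kronecker, Matrix.kronecker_smul]
    abel
  rw [this]
  exact ((hae.kron_right b).add (he.kron_left a)).sub ((hbc.mul_left _).kron_left h)

lemma IsMor.red_of_smul_one (hs : s ∉ p) {r : Matrix Y.ι X.ι R}
    (hr : IsMor X Y r) (hI : EntriesIn (p ⊔ Ideal.span {s}) r) (hsY : Red p Y Y (s • 1)) :
    Red p X Y r := by
  obtain ⟨b, e, rfl, hb, he, hbc⟩ := hr.exists_smul_add hs hI
  obtain ⟨h, hh, hae⟩ := hsY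
  refine ⟨h * b, hh.mul_even hb, ?_⟩
  have : s • b + e - bd X Y (h * b) =
      (s • 1 - bd Y Y h) * b + e - h * (b * X.D - Y.D * b) := by
    simp only [bd, Matrix.sub_mul, Matrix.add_mul, Matrix.mul_sub, Matrix.smul_mul,
      Matrix.one_mul, Matrix.mul_assoc]
    abel
  rw [this]
  exact ((hae.mul_right b).add he).sub (hbc.mul_left h)

lemma RedPow.succ_of_red_smul (hs : s ∉ p) (hE : IsFact 0 E) (hF : IsFact 0 F)
    (ha : IsMor E F a) (hsa : Red p E F (s • a)) :
    ∀ (n : ℕ) {X Y : SuperObj R} {f : Matrix Y.ι X.ι R}, IsFact w X → IsFact w Y →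
      IsMor X Y f → RedPow a (p ⊔ Ideal.span {s}) n X Y f → RedPow a p (n + 1) X Y f
  | 0, _, _, _, hX, hY, hf, ⟨_, hh, he⟩ => RedPow.of_homotopic ha 1 hh
      ((hf.sub_bd hX hY hh).red_kron hs hY.1 he hsa)
  | n + 1, _, _, _, hX, hY, hf, H => RedPow.succ_of_red_smul hs hE hF ha hsa n
      (hX.tens hE) (hY.tens hF) (hf.kron ha) H

lemma RedPow.of_red_smul_one (hs : s ∉ p) (hE : IsFact 0 E) (hF : IsFact 0 F)
    (ha : IsMor E F a) {G : SuperObj R} (hsG : Red p G G (s • 1)) :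
    ∀ (n : ℕ) {X Y : SuperObj R} {f : Matrix Y.ι X.ι R}, IsFact w X → IsFact w Y →
      Dominates G Y → IsMor X Y f → RedPow a (p ⊔ Ideal.span {s}) n X Y f → RedPow a p n X Y f
  | 0, _, _, _, hX, hY, hG, hf, ⟨_, hh, he⟩ => RedPow.of_homotopic ha 0 hh
      ((hf.sub_bd hX hY hh).red_of_smul_one hs he (hG p s hsG))
  | n + 1, _, _, _, hX, hY, hG, hf, H => RedPow.of_red_smul_one hs hE hF ha hsG n
      (hX.tens hE) (hY.tens hF) (hG.tens F) (hf.kron ha) H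

end Prime

/-- Noetherian induction on the ideal modulo which the tensor power is null-homotopic. -/
theorem exists_redPow [IsNoetherianRing R] {w : R} {a : Matrix F.ι E.ι R} {G : SuperObj R}
    (hE : IsFact 0 E) (hF : IsFact 0 F) (ha : IsMor E F a)
    (H : ∀ p : Ideal R, p.IsPrime → ∃ s ∉ p, Red p E F (s • a) ∨ Red p G G (s • 1))
    (I : Ideal R) :
    ∃ n, ∀ Y : SuperObj R, IsFact w Y → Dominates G Y → RedPow a I n Y Y 1 := by
  induction I using WellFoundedGT.induction with
  | ind I ih =>
  have lt_sup : ∀ x ∉ I, I < I ⊔ Ideal.span {x} := fun x hx =>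
    left_lt_sup.2 fun h => hx (h (Ideal.mem_span_singleton_self x))
  by_cases hp : I.IsPrime
  · obtain ⟨s, hs, hred⟩ := H I hp
    obtain ⟨n, hn⟩ := ih _ (lt_sup s hs)
    rcases hred with hsa | hsG
    · exact ⟨n + 1, fun Y hY hG =>
        RedPow.succ_of_red_smul hs hE hF ha hsa n hY hY (isMor_one Y) (hn Y hY hG)⟩
    · exact ⟨n, fun Y hY hG =>
        RedPow.of_red_smul_one hs hE hF ha hsG n hY hY hG (isMor_one Y) (hn Y hY hG)⟩
  · rcases Ideal.not_isPrime_iff.1 hp with rfl | ⟨x, hx, y, hy, hxy⟩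
    · exact ⟨0, fun Y _ _ => Red.of_entriesIn fun _ _ => trivial⟩
    · obtain ⟨n, hn⟩ := ih _ (lt_sup x hx)
      obtain ⟨m, hm⟩ := ih _ (lt_sup y hy)
      refine ⟨n + m, fun Y hY hG => RedPow.mono ?_ _
        (RedPow.add hE hF ha m hm n hY hY hG (isMor_one Y) (hn Y hY hG))⟩
      rw [Ideal.sup_mul, Ideal.mul_sup (Ideal.span {y}), Ideal.span_singleton_mul_span_singleton y x]
      exact sup_le Ideal.mul_le_left
        (sup_le Ideal.mul_le_right ((Ideal.span_singleton_le_iff_mem _).2 (mul_comm x y ▸ hxy)))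
/-- An isomorphism given by a bijection of the homogeneous bases. -/
structure Iso (X X' : SuperObj R) where
  e : X.ι ≃ X'.ι
  par : ∀ i, X'.par (e i) = X.par i
  D : X'.D.submatrix e e = X.D

namespace Iso

variable {X' : SuperObj R}

lemma sgn (u : Iso X X') : X'.sgn.submatrix u.e u.e = X.sgn := by
  ext i j
  simp [SuperObj.sgn, Matrix.diagonal_apply, u.par]

/-- The identity isomorphism. -/
def refl (X : SuperObj R) : Iso X X := ⟨.refl _, fun _ => rfl, rfl⟩

/-- The tensor product of isomorphisms. -/
def tens {E' : SuperObj R} (u : Iso X X') (v : Iso E E') : Iso (X.tens E) (X'.tens E') where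
  e := u.e.prodCongr v.e
  par i := by simp [u.par, v.par]
  D := by
    simp only [SuperObj.tens, ← u.D, ← u.sgn, ← v.D]
    ext ⟨i, i'⟩ ⟨j, j'⟩
    simp [Matrix.one_apply]

/-- Associativity of the tensor product. -/
def assoc (X Y Z : SuperObj R) : Iso (X.tens (Y.tens Z)) ((X.tens Y).tens Z) where
  e := (Equiv.prodAssoc X.ι Y.ι Z.ι).symm
  par i := by simp
  D := by
    ext ⟨i, i', i''⟩ ⟨j, j', j''⟩
    have hs : (X.tens Y).sgn (i, i') (j, j') = X.sgn i j * Y.sgn i' j' := by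
      simp only [SuperObj.sgn, Matrix.diagonal_apply, Prod.mk.injEq]
      split_ifs <;> simp_all
    simp only [Matrix.submatrix_apply, Equiv.prodAssoc_symm_apply, Matrix.add_apply,
      Matrix.kronecker_apply, hs, Matrix.one_apply, Prod.mk.injEq]
    by_cases h' : i' = j' <;> by_cases h'' : i'' = j'' <;> simp [h', h''] <;> ring

end Iso

lemma Red.of_iso {I : Ideal R} {X' Y' : SuperObj R} (u : Iso X X') (v : Iso Y Y')
    {f : Matrix Y'.ι X'.ι R} (hf : Red I X' Y' f) : Red I X Y (f.submatrix v.e u.e) := by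
  obtain ⟨h, hh, he⟩ := hf
  refine ⟨h.submatrix v.e u.e, fun i j hij => hh _ _ (by rw [u.par, v.par, hij]), ?_⟩
  have : bd X Y (h.submatrix v.e u.e) = (bd X' Y' h).submatrix v.e u.e := by
    rw [bd, bd, ← u.D, ← v.D, Matrix.submatrix_mul_equiv, Matrix.submatrix_mul_equiv]
    rfl
  rw [this]
  exact fun i j => he _ _

lemma RedPow.of_iso {I : Ideal R} {a : Matrix F.ι E.ι R} : ∀ (n : ℕ) {X X' Y Y' : SuperObj R}
    (u : Iso X X') (v : Iso Y Y') {f : Matrix Y'.ι X'.ι R},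
    RedPow a I n X' Y' f → RedPow a I n X Y (f.submatrix v.e u.e)
  | 0, _, _, _, _, u, v, _, h => Red.of_iso u v h
  | n + 1, _, _, _, _, u, v, _, h => of_iso n (u.tens (Iso.refl E)) (v.tens (Iso.refl F)) h

end SuperObj

namespace MF

variable {R : Type} [CommRing R]

open SuperObj

/-- The total graded module of a matrix factorization. -/
abbrev total (E : MF R) : SuperObj R where
  ι := E.ι0 ⊕ E.ι1
  par := Sum.isRight
  D := Matrix.fromBlocks 0 E.A E.B 0

/-- The total map of a morphism of matrix factorizations. -/
abbrev Hom.total {E F : MF R} (f : Hom E F) : Matrix F.total.ι E.total.ι R :=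
  Matrix.fromBlocks f.f0 0 0 f.f1

lemma IsMF.total {w : R} {E : MF R} (h : E.IsMF w) : IsFact w E.total := by
  refine ⟨?_, ?_⟩
  · rintro (i | i) (j | j) hij <;> simp_all
  · rw [← Matrix.fromBlocks_one, Matrix.fromBlocks_smul]
    simp [Matrix.fromBlocks_multiply, h.1, h.2]

lemma Hom.IsHom.total {E F : MF R} {f : Hom E F} (h : f.IsHom) :
    IsMor E.total F.total f.total := by
  refine ⟨?_, ?_⟩
  · rintro (i | i) (j | j) hij <;> simp_all
  · simp [Matrix.fromBlocks_multiply, h.1, h.2]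

lemma isOdd_fromBlocks {E F : MF R} (h0 : Matrix F.ι1 E.ι0 R) (h1 : Matrix F.ι0 E.ι1 R) :
    IsOdd E.total F.total (Matrix.fromBlocks 0 h1 h0 0) := by
  rintro (i | i) (j | j) hij <;> simp_all

lemma Hom.nullHomotopic_of_red {E F : MF R} {f : Hom E F}
    (h : Red ⊥ E.total F.total f.total) : f.NullHomotopic := by
  obtain ⟨k, -, hk⟩ := h
  have hk' : f.total = bd E.total F.total k :=
    sub_eq_zero.1 (Matrix.ext fun i j => Ideal.mem_bot.1 (hk i j))
  rw [← Matrix.fromBlocks_toBlocks k] at hk'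
  simp only [bd, Matrix.fromBlocks_multiply, Matrix.fromBlocks_add, Hom.total,
    Matrix.zero_mul, Matrix.mul_zero, zero_add, add_zero] at hk'
  obtain ⟨h00, -, -, h11⟩ := Matrix.fromBlocks_inj.1 hk'
  exact ⟨k.toBlocks₂₁, k.toBlocks₁₂, h00, h11⟩

/-- The homogeneous basis of a tensor product is the product of the bases. -/
def tensorFun (E F : MF R) :
    (E.ι0 × F.ι0 ⊕ E.ι1 × F.ι1) ⊕ (E.ι1 × F.ι0 ⊕ E.ι0 × F.ι1) →
      (E.ι0 ⊕ E.ι1) × (F.ι0 ⊕ F.ι1)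
  | .inl (.inl (i, j)) => (.inl i, .inl j)
  | .inl (.inr (i, j)) => (.inr i, .inr j)
  | .inr (.inl (i, j)) => (.inr i, .inl j)
  | .inr (.inr (i, j)) => (.inl i, .inr j)

lemma tens_D_tensorFun (E F : MF R) (x y) :
    (E.total.tens F.total).D (tensorFun E F x) (tensorFun E F y) =
      (Matrix.fromBlocks 0
        (Matrix.fromBlocks (E.A ⊗ₖ 1) (1 ⊗ₖ F.A) (-(1 ⊗ₖ F.B)) (E.B ⊗ₖ 1))
        (Matrix.fromBlocks (E.B ⊗ₖ 1) (-(1 ⊗ₖ F.A)) (1 ⊗ₖ F.B) (E.A ⊗ₖ 1)) 0 :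
        Matrix ((E.ι0 × F.ι0 ⊕ E.ι1 × F.ι1) ⊕ (E.ι1 × F.ι0 ⊕ E.ι0 × F.ι1)) _ R) x y := by
  obtain ((⟨i, j⟩ | ⟨i, j⟩) | (⟨i, j⟩ | ⟨i, j⟩)) := x <;>
    obtain ((⟨i', j'⟩ | ⟨i', j'⟩) | (⟨i', j'⟩ | ⟨i', j'⟩)) := y <;>
    simp [tensorFun, SuperObj.sgn, Matrix.one_apply, Matrix.diagonal_apply] <;>
    split_ifs <;> simp

/-- Total modules are compatible with tensor products. -/
def tensorIso (E F : MF R) : Iso (E.tensor F).total (E.total.tens F.total) where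
  e :=
    { toFun := tensorFun E F
      invFun := fun
        | (.inl i, .inl j) => .inl (.inl (i, j))
        | (.inr i, .inr j) => .inl (.inr (i, j))
        | (.inr i, .inl j) => .inr (.inl (i, j))
        | (.inl i, .inr j) => .inr (.inr (i, j))
      left_inv := by rintro ((⟨i, j⟩ | ⟨i, j⟩) | (⟨i, j⟩ | ⟨i, j⟩)) <;> rfl
      right_inv := by rintro ⟨i | i, j | j⟩ <;> rfl }
  par := by rintro ((⟨i, j⟩ | ⟨i, j⟩) | (⟨i, j⟩ | ⟨i, j⟩)) <;> rfl
  D := Matrix.ext (tens_D_tensorFun E F)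

lemma Hom.kron_tensorFun {E E' F F' : MF R} (f : Hom E E') (g : Hom F F') (x y) :
    (f.total ⊗ₖ g.total) (tensorFun E' F' x) (tensorFun E F y) =
      (Matrix.fromBlocks (Matrix.fromBlocks (f.f0 ⊗ₖ g.f0) 0 0 (f.f1 ⊗ₖ g.f1)) 0 0
        (Matrix.fromBlocks (f.f1 ⊗ₖ g.f0) 0 0 (f.f0 ⊗ₖ g.f1)) :
        Matrix ((E'.ι0 × F'.ι0 ⊕ E'.ι1 × F'.ι1) ⊕ (E'.ι1 × F'.ι0 ⊕ E'.ι0 × F'.ι1))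
          ((E.ι0 × F.ι0 ⊕ E.ι1 × F.ι1) ⊕ (E.ι1 × F.ι0 ⊕ E.ι0 × F.ι1)) R) x y := by
  obtain ((⟨i, j⟩ | ⟨i, j⟩) | (⟨i, j⟩ | ⟨i, j⟩)) := x <;>
    obtain ((⟨i', j'⟩ | ⟨i', j'⟩) | (⟨i', j'⟩ | ⟨i', j'⟩)) := y <;>
    simp [tensorFun]

lemma Hom.total_tensor {E E' F F' : MF R} (f : Hom E E') (g : Hom F F') :
    (f.total ⊗ₖ g.total).submatrix (tensorIso E' F').e (tensorIso E F).e =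
      (f.tensor g).total := Matrix.ext (Hom.kron_tensorFun f g)

lemma Hom.exists_red_pow1 {E F G H : MF R} (a : Hom E F) (g : Hom G H) {I : Ideal R} :
    ∀ (n k : ℕ), RedPow a.total I n (G.total.tens (E.pow1 k).total)
        (H.total.tens (F.pow1 k).total) (g.total ⊗ₖ (a.pow1 k).total) →
      ∃ m, Red I (G.tensor (E.pow1 m)).total (H.tensor (F.pow1 m)).total
        (g.tensor (a.pow1 m)).total
  | 0, k, h => ⟨k, by
      rw [← Hom.total_tensor]
      exact Red.of_iso (tensorIso G (E.pow1 k)) (tensorIso H (F.pow1 k)) h⟩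
  | n + 1, k, h => Hom.exists_red_pow1 a g n (k + 1) (by
      have h2 := RedPow.of_iso n ((Iso.refl G.total).tens (tensorIso (E.pow1 k) E))
        ((Iso.refl H.total).tens (tensorIso (F.pow1 k) F))
        (RedPow.of_iso n (Iso.assoc G.total (E.pow1 k).total E.total)
          (Iso.assoc H.total (F.pow1 k).total F.total) h)
      refine (congr_arg (RedPow a.total I n _ _) (Matrix.ext ?_)).mp h2
      rintro ⟨i, i'⟩ ⟨j, j'⟩
      change _ = g.total i j * ((a.pow1 k).tensor a).total i' j'
      rw [← Hom.total_tensor]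
      exact mul_assoc _ _ _)

lemma entriesIn_smul_sub {K : Type} [CommRing K] {φ : R →+* K} {p : Ideal R}
    (hφ : ∀ x, φ x = 0 → x ∈ p)
    {l m n k : Type} [Fintype m] [Fintype n] {s : R} {f : Matrix l k R} {A : Matrix l m R}
    {B : Matrix n k R} {n0 : Matrix m k R} {n1 : Matrix l n R} {h0 : Matrix m k K}
    {h1 : Matrix l n K} (hn0 : n0.map φ = φ s • h0) (hn1 : n1.map φ = φ s • h1)
    (hf : f.map φ = A.map φ * h0 + h1 * B.map φ) :
    EntriesIn p (s • f - (A * n0 + n1 * B)) := by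
  have : (s • f - (A * n0 + n1 * B)).map φ = 0 := by
    rw [Matrix.map_sub _ (map_sub _), Matrix.map_add _ (map_add _), Matrix.map_mul,
      Matrix.map_mul, hn0, hn1, Matrix.mul_smul, Matrix.smul_mul, ← smul_add, ← hf, sub_eq_zero]
    ext i j
    simp
  exact fun i j => hφ _ (congr_fun₂ this i j)

section Residue

variable (p : Ideal R) [p.IsPrime]

lemma exists_clear_denominators {α : Type} [Finite α] (c : α → p.ResidueField) :
    ∃ s ∉ p, ∃ n : α → R, ∀ i,
      algebraMap R p.ResidueField (n i) = algebraMap R p.ResidueField s * c i := by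
  obtain ⟨⟨b, hb⟩, h⟩ := IsLocalization.exist_integer_multiples_of_finite
    (nonZeroDivisors (R ⧸ p)) c
  obtain ⟨s, rfl⟩ := Ideal.Quotient.mk_surjective b
  choose n hn using h
  choose n' hn' using fun i => Ideal.Quotient.mk_surjective (n i)
  refine ⟨s, fun hs => nonZeroDivisors.ne_zero hb (Ideal.Quotient.eq_zero_iff_mem.2 hs), n',
    fun i => ?_⟩
  have := hn i
  rw [← hn', Algebra.smul_def] at this
  exact this

lemma Hom.exists_red_smul {E F : MF R} {f : Hom E F}
    (hf : (f.map (algebraMap R p.ResidueField)).NullHomotopic) :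
    ∃ s ∉ p, Red p E.total F.total (s • f.total) := by
  obtain ⟨h0, h1, hf0, hf1⟩ := hf
  obtain ⟨s, hs, n, hn⟩ := exists_clear_denominators p
    (Sum.elim (fun x : F.ι1 × E.ι0 => h0 x.1 x.2) (fun x : F.ι0 × E.ι1 => h1 x.1 x.2))
  let n0 : Matrix F.ι1 E.ι0 R := .of fun i j => n (.inl (i, j))
  let n1 : Matrix F.ι0 E.ι1 R := .of fun i j => n (.inr (i, j))
  have hn0 : n0.map (algebraMap R p.ResidueField) = algebraMap R p.ResidueField s • h0 :=
    Matrix.ext fun i j => hn (.inl (i, j))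
  have hn1 : n1.map (algebraMap R p.ResidueField) = algebraMap R p.ResidueField s • h1 :=
    Matrix.ext fun i j => hn (.inr (i, j))
  have mem : ∀ x : R, algebraMap R p.ResidueField x = 0 → x ∈ p :=
    fun x => p.algebraMap_residueField_eq_zero.1
  have key0 := entriesIn_smul_sub mem hn0 hn1 hf0
  have key1 := entriesIn_smul_sub mem hn1 hn0 hf1
  refine ⟨s, hs, Matrix.fromBlocks 0 n1 n0 0, isOdd_fromBlocks n0 n1, ?_⟩
  simp only [bd, Matrix.fromBlocks_multiply, Matrix.fromBlocks_add, Hom.total,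
    Matrix.fromBlocks_smul, Matrix.zero_mul, Matrix.mul_zero, zero_add, add_zero, smul_zero]
  rintro (i | i) (j | j)
  · exact key0 i j
  · simp
  · simp
  · exact key1 i j

lemma exists_red_smul_one {G : MF R}
    (hG : Contractible (G.map (algebraMap R (Localization.AtPrime p)))) :
    ∃ s ∉ p, Red p G.total G.total (s • 1) := by
  obtain ⟨h0, h1, e0, e1⟩ := hG
  let π := IsLocalRing.residue (Localization.AtPrime p)
  have hnull : ((Hom.id G).map (algebraMap R p.ResidueField)).NullHomotopic := by
    refine ⟨h0.map π, h1.map π, ?_, ?_⟩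
    · have := congr_arg (fun M => M.map π) e0
      rw [Matrix.map_add _ (map_add _), Matrix.map_mul, Matrix.map_mul] at this
      refine Eq.trans ?_ this
      simp [Hom.map, Hom.id]
      rfl
    · have := congr_arg (fun M => M.map π) e1
      rw [Matrix.map_add _ (map_add _), Matrix.map_mul, Matrix.map_mul] at this
      refine Eq.trans ?_ this
      simp [Hom.map, Hom.id]
      rfl
  have := Hom.exists_red_smul p hnull
  rwa [Hom.total, Hom.id, Matrix.fromBlocks_one] at this

end Residue

end MF

theorem stmt11 (R : Type) [CommRing R] [IsNoetherianRing R] (W : R)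
    (E F : MF R) (hE : E.IsMF 0) (hF : F.IsMF 0)
    (a : MF.Hom E F) (ha : a.IsHom)
    (G : MF R) (hG : G.IsMF W)
    (h : ∀ p ∈ G.Supp,
      (a.map ((IsLocalRing.residue (Localization.AtPrime p.asIdeal)).comp
        (algebraMap R (Localization.AtPrime p.asIdeal)))).NullHomotopic) :
    ∃ n : ℕ, ((MF.Hom.id G).tensor (a.pow1 n)).NullHomotopic := by
  have hid : (MF.Hom.id G).total = 1 := Matrix.fromBlocks_one
  obtain ⟨n, hn⟩ := SuperObj.exists_redPow (w := W) (a := a.total) (G := G.total)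
    hE.total hF.total ha.total (fun p hp => by
      by_cases hpG : (⟨p, hp⟩ : PrimeSpectrum R) ∈ G.Supp
      · obtain ⟨s, hs, hr⟩ := MF.Hom.exists_red_smul p (h ⟨p, hp⟩ hpG)
        exact ⟨s, hs, .inl hr⟩
      · obtain ⟨s, hs, hr⟩ := MF.exists_red_smul_one p (not_not.1 hpG)
        exact ⟨s, hs, .inr hr⟩) ⊥
  have hpow := SuperObj.RedPow.succ ha.total n (hn G.total hG.total fun _ _ => id)
  rw [← hid] at hpow
  obtain ⟨m, hm⟩ := MF.Hom.exists_red_pow1 a (MF.Hom.id G) n 0 hpow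
  exact ⟨m, MF.Hom.nullHomotopic_of_red hm⟩
end

section
/- Let S be a commutative ring and E a matrix factorization of 0 over S. Let e ∈ ker(φ₀ᴱ) ⊆ E₀, and suppose there exist u ∈ E₁ and v ∈ E₀ with e = φ₁ᴱ(u) + v and v^{⊗n} = 0 in the tensor power E₀^{⊗n} for some n ≥ 1. Then, regarding e^{⊗n} as an element of (E^{⊗n})₀ via the canonical inclusion E₀^{⊗n} ↪ (E^{⊗n})₀, there exists w ∈ (E^{⊗n})₁ with φ₁^{E^{⊗n}}(w) = e^{⊗n}; in particular e^{⊗n} = 0 in H₀(E^{⊗n}) = ker(φ₀^{E^{⊗n}})/im(φ₁^{E^{⊗n}}). -/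
open Matrix Kronecker

namespace MF
/-- `vecPow E e n` is the pure tensor power `e^{⊗(n+1)} ∈ E₀^{⊗(n+1)}`, regarded as an
element of the degree-zero component of `E^{⊗(n+1)}` via the canonical inclusion
`E₀^{⊗(n+1)} ↪ (E^{⊗(n+1)})₀` (the inclusion of the summand indexed by zeros). -/
def vecPow {S : Type} [CommRing S] (E : MF S) (e : E.ι0 → S) : (n : ℕ) → ((E.pow1 n).ι0 → S)
  | 0 => e
  | n + 1 => Sum.elim (fun q => vecPow E e n q.1 * e q.2) (fun _ => 0)
end MF

theorem Matrix.kronecker_mulVec_mul {R l m n p : Type*} [CommSemiring R] [Fintype m] [Fintype p]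
    (A : Matrix l m R) (B : Matrix n p R) (x : m → R) (y : p → R) :
    (A ⊗ₖ B) *ᵥ (fun q => x q.1 * y q.2) = fun q => (A *ᵥ x) q.1 * (B *ᵥ y) q.2 := by
  ext ⟨i, j⟩
  simp only [Matrix.mulVec, dotProduct, Matrix.kroneckerMap_apply, Fintype.sum_prod_type,
    Finset.sum_mul_sum]
  exact Finset.sum_congr rfl fun _ _ => Finset.sum_congr rfl fun _ _ => by ring

namespace MF

variable {S : Type} [CommRing S]

theorem tensor_A_mulVec (E F : MF S) (t : E.ι1 → S) (e : F.ι0 → S) (x : E.ι0 → S)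
    (u : F.ι1 → S) :
    (E.tensor F).A *ᵥ Sum.elim (fun q => t q.1 * e q.2) (fun q => x q.1 * u q.2) =
      Sum.elim (fun q => (E.A *ᵥ t) q.1 * e q.2 + x q.1 * (F.A *ᵥ u) q.2)
        (fun q => -(t q.1 * (F.B *ᵥ e) q.2) + (E.B *ᵥ x) q.1 * u q.2) := by
  refine (Matrix.fromBlocks_mulVec _ _ _ _ _).trans ?_
  simp only [Sum.elim_comp_inl, Sum.elim_comp_inr, Matrix.neg_mulVec,
    Matrix.kronecker_mulVec_mul, Matrix.one_mulVec]
  rfl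

theorem tensor_B_mulVec (E F : MF S) (x : E.ι0 → S) (y : F.ι0 → S) :
    (E.tensor F).B *ᵥ Sum.elim (fun q => x q.1 * y q.2) (fun _ => 0) =
      Sum.elim (fun q => (E.B *ᵥ x) q.1 * y q.2) (fun q => x q.1 * (F.B *ᵥ y) q.2) := by
  refine (Matrix.fromBlocks_mulVec _ _ _ _ _).trans ?_
  have h0 : (fun _ : E.ι1 × F.ι1 => (0 : S)) = 0 := rfl
  simp only [Sum.elim_comp_inl, Sum.elim_comp_inr, h0, Matrix.mulVec_zero, add_zero,
    Matrix.kronecker_mulVec_mul, Matrix.one_mulVec]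

theorem pow1_B_mulVec_vecPow (E : MF S) (v : E.ι0 → S) (hv : E.B *ᵥ v = 0) (n : ℕ) :
    (E.pow1 n).B *ᵥ E.vecPow v n = 0 := by
  induction n with
  | zero => exact hv
  | succ n ih =>
    refine (tensor_B_mulVec (E.pow1 n) E (E.vecPow v n) v).trans ?_
    rw [ih, hv]
    ext (q | q)
    · exact zero_mul _
    · exact mul_zero _

theorem exists_vecPow_eq_pow1_A_mulVec_add (E : MF S) (e v : E.ι0 → S) (u : E.ι1 → S)
    (he : E.B *ᵥ e = 0) (hv : E.B *ᵥ v = 0) (huv : e = E.A *ᵥ u + v) (n : ℕ) :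
    ∃ t, E.vecPow e n = (E.pow1 n).A *ᵥ t + E.vecPow v n := by
  induction n with
  | zero => exact ⟨u, huv⟩
  | succ n ih =>
    obtain ⟨t, ht⟩ := ih
    refine ⟨Sum.elim (fun q => t q.1 * e q.2) (fun q => E.vecPow v n q.1 * u q.2), ?_⟩
    refine Eq.trans ?_ (congrArg (· + E.vecPow v (n + 1))
      (tensor_A_mulVec (E.pow1 n) E t e (E.vecPow v n) u).symm)
    rw [pow1_B_mulVec_vecPow E v hv n, he]
    ext (q | q)
    · have h1 := congrFun ht q.1
      have h2 := congrFun huv q.2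
      simp only [Pi.add_apply] at h1 h2
      change E.vecPow e n q.1 * e q.2 = ((E.pow1 n).A *ᵥ t) q.1 * e q.2 +
        E.vecPow v n q.1 * (E.A *ᵥ u) q.2 + E.vecPow v n q.1 * v q.2
      linear_combination e q.2 * h1 + E.vecPow v n q.1 * h2
    · change (0 : S) = -(t q.1 * 0) + 0 * u q.2 + 0
      ring

theorem vecPow_eq_zero_or_prod (E : MF S) (v : E.ι0 → S) (n : ℕ) (q : (E.pow1 n).ι0) :
    E.vecPow v n q = 0 ∨ ∃ w : Fin (n + 1) → E.ι0, E.vecPow v n q = ∏ i, v (w i) := by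
  induction n with
  | zero => exact Or.inr ⟨fun _ => q, by simp [vecPow]⟩
  | succ n ih =>
    obtain q | q := q
    · obtain h | ⟨w, h⟩ := ih q.1
      · exact Or.inl (by simp [vecPow, h])
      · exact Or.inr ⟨Fin.snoc w q.2, by simp [vecPow, h, Fin.prod_univ_castSucc (n := n + 1)]⟩
    · exact Or.inl rfl

end MF

theorem stmt12 (S : Type) [CommRing S] (E : MF S) (hE : E.IsMF 0)
    (e : E.ι0 → S) (he : E.B.mulVec e = 0)
    (u : E.ι1 → S) (v : E.ι0 → S) (huv : e = E.A.mulVec u + v)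
    (n : ℕ) (hv : ∀ w : Fin (n + 1) → E.ι0, ∏ i, v (w i) = 0) :
    ∃ t : (E.pow1 n).ι1 → S, (E.pow1 n).A.mulVec t = MF.vecPow E e n := by
  have hBv : E.B *ᵥ v = 0 := by
    have h := he
    rw [huv, Matrix.mulVec_add, Matrix.mulVec_mulVec, hE.1] at h
    simpa using h
  obtain ⟨t, ht⟩ := E.exists_vecPow_eq_pow1_A_mulVec_add e v u he hBv huv n
  have hvn : E.vecPow v n = 0 := by
    ext q
    obtain h | ⟨w, h⟩ := E.vecPow_eq_zero_or_prod v n q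
    · exact h
    · exact h.trans (hv w)
  exact ⟨t, by rw [ht, hvn, add_zero]⟩
end

section
/- Let (R, m) be a commutative local ring, w ∈ R, and F a matrix factorization of w over R. Then F is contractible if and only if the base change F ⊗ R/m, a matrix factorization of the image of w over the residue field R/m, is contractible. -/
open Matrix

namespace MF

variable {R S : Type} [CommRing R] [CommRing S]

/-- Contractibility is preserved by base change. -/
theorem Contractible.map {F : MF R} (hF : F.Contractible) (f : R →+* S) :
    (F.map f).Contractible := by
  obtain ⟨h0, h1, e0, e1⟩ := hF
  refine ⟨h0.map f, h1.map f, ?_, ?_⟩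
  · have e := congrArg (fun M => M.map f) e0
    simp only [Matrix.map_one f f.map_zero f.map_one, Matrix.map_add f (map_add f),
      Matrix.map_mul] at e
    exact e
  · have e := congrArg (fun M => M.map f) e1
    simp only [Matrix.map_one f f.map_zero f.map_one, Matrix.map_add f (map_add f),
      Matrix.map_mul] at e
    exact e

/-- If a null-homotopic endomorphism of a matrix factorization is invertible, then the
matrix factorization is contractible. -/
theorem IsMF.contractible_of_isUnit {w : R} {F : MF R} (hF : F.IsMF w)
    {h0 : Matrix F.ι1 F.ι0 R} {h1 : Matrix F.ι0 F.ι1 R}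
    (hU0 : IsUnit (F.A * h0 + h1 * F.B)) (hU1 : IsUnit (F.B * h1 + h0 * F.A)) :
    F.Contractible := by
  obtain ⟨hBA, hAB⟩ := hF
  have hA : F.A * (F.B * h1 + h0 * F.A) = (F.A * h0 + h1 * F.B) * F.A := by
    rw [Matrix.mul_add, Matrix.add_mul, ← Matrix.mul_assoc, hAB, Matrix.mul_assoc h1, hBA,
      Matrix.mul_assoc]
    simp [add_comm]
  have hB : F.B * (F.A * h0 + h1 * F.B) = (F.B * h1 + h0 * F.A) * F.B := by
    rw [Matrix.mul_add, Matrix.add_mul, ← Matrix.mul_assoc, hBA, Matrix.mul_assoc h0, hAB,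
      Matrix.mul_assoc]
    simp [add_comm]
  obtain ⟨V0, hV0, -⟩ := isUnit_iff_exists.mp hU0
  obtain ⟨V1, hV1, -⟩ := isUnit_iff_exists.mp hU1
  have hV0' := mul_eq_one_comm.mp hV0
  have hV1' := mul_eq_one_comm.mp hV1
  have hA' : V0 * F.A = F.A * V1 := by
    calc V0 * F.A = V0 * (F.A * (F.B * h1 + h0 * F.A)) * V1 := by
          rw [Matrix.mul_assoc, Matrix.mul_assoc, hV1, Matrix.mul_one]
      _ = F.A * V1 := by rw [hA, ← Matrix.mul_assoc, hV0', Matrix.one_mul]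
  have hB' : V1 * F.B = F.B * V0 := by
    calc V1 * F.B = V1 * (F.B * (F.A * h0 + h1 * F.B)) * V0 := by
          rw [Matrix.mul_assoc, Matrix.mul_assoc, hV0, Matrix.mul_one]
      _ = F.B * V0 := by rw [hB, ← Matrix.mul_assoc, hV1', Matrix.one_mul]
  refine ⟨h0 * V0, h1 * V1, ?_, ?_⟩
  · rw [Matrix.mul_assoc h1, hB', ← Matrix.mul_assoc, ← Matrix.mul_assoc, ← Matrix.add_mul, hV0]
  · rw [Matrix.mul_assoc h0, hA', ← Matrix.mul_assoc, ← Matrix.mul_assoc, ← Matrix.add_mul, hV1]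

end MF

/-- A square matrix is invertible if its image under a local ring homomorphism is the identity. -/
theorem Matrix.isUnit_of_map_eq_one {R S n : Type*} [CommRing R] [CommRing S] [Fintype n]
    [DecidableEq n] (f : R →+* S) [IsLocalHom f] {M : Matrix n n R} (hM : M.map f = 1) :
    IsUnit M := by
  rw [Matrix.isUnit_iff_isUnit_det]
  apply isUnit_of_map_unit f
  rw [RingHom.map_det, RingHom.mapMatrix_apply, hM, Matrix.det_one]
  exact isUnit_one

/-- Contractibility descends along a surjective local ring homomorphism. -/
theorem MF.IsMF.contractible_of_map {R S : Type} [CommRing R] [CommRing S] {w : R} {F : MF R}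
    (hF : F.IsMF w) (f : R →+* S) [IsLocalHom f] (hf : Function.Surjective f)
    (h : (F.map f).Contractible) : F.Contractible := by
  obtain ⟨k0, k1, e0, e1⟩ := h
  obtain ⟨h0, rfl⟩ : ∃ h0 : Matrix F.ι1 F.ι0 R, h0.map f = k0 :=
    ⟨k0.map (Function.surjInv hf), by ext i j; exact Function.surjInv_eq hf _⟩
  obtain ⟨h1, rfl⟩ : ∃ h1 : Matrix F.ι0 F.ι1 R, h1.map f = k1 :=
    ⟨k1.map (Function.surjInv hf), by ext i j; exact Function.surjInv_eq hf _⟩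
  refine hF.contractible_of_isUnit (h0 := h0) (h1 := h1)
    (Matrix.isUnit_of_map_eq_one f ?_) (Matrix.isUnit_of_map_eq_one f ?_)
  · rw [Matrix.map_add f (map_add f), Matrix.map_mul, Matrix.map_mul]
    exact e0.symm
  · rw [Matrix.map_add f (map_add f), Matrix.map_mul, Matrix.map_mul]
    exact e1.symm

theorem stmt13 (R : Type) [CommRing R] [IsLocalRing R] (w : R)
    (F : MF R) (hF : F.IsMF w) :
    F.Contractible ↔ (F.map (IsLocalRing.residue R)).Contractible :=
  ⟨fun h => h.map _, hF.contractible_of_map _ IsLocalRing.residue_surjective⟩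
end

section
/- Let R be a commutative ring, f₀, f₁ ∈ R, and let F be the matrix factorization (R →f₁→ R →f₀→ R) of f₀f₁ over R, i.e., F₁ = F₀ = R with φ₁ = multiplication by f₁ and φ₀ = multiplication by f₀. Then for every prime ideal p of R, the localization F_p is not contractible over R_p if and only if f₀ ∈ p and f₁ ∈ p; that is, Supp(F) = V(f₀) ∩ V(f₁). -/
open Matrix

/-- The rank-one matrix factorization `(R --f₁--> R --f₀--> R)` of `f₀ * f₁`. -/
def koszulMF (R : Type) [CommRing R] (f1 f0 : R) : MF R where
  ι1 := Unit
  ι0 := Unit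
  A := Matrix.of fun _ _ => f1
  B := Matrix.of fun _ _ => f0

/-- A rank-one matrix factorization is contractible iff its two structure maps are comaximal. -/
theorem koszulMF_contractible_iff {S : Type} [CommRing S] (a b : S) :
    (koszulMF S a b).Contractible ↔ IsCoprime a b := by
  suffices h : (∃ h0 h1 : Matrix Unit Unit S,
      1 = (Matrix.of fun _ _ => a : Matrix Unit Unit S) * h0 + h1 * (Matrix.of fun _ _ => b) ∧
      1 = (Matrix.of fun _ _ => b : Matrix Unit Unit S) * h1 + h0 * (Matrix.of fun _ _ => a)) ↔
      IsCoprime a b from h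
  simp only [← Matrix.ext_iff, Matrix.add_apply, Matrix.mul_apply, Matrix.of_apply,
    Finset.univ_unique, Finset.sum_singleton, Unique.forall_iff, Matrix.one_apply_eq]
  constructor
  · rintro ⟨h0, h1, -, h⟩
    exact ⟨h0 () (), h1 () (), by linear_combination -h⟩
  · rintro ⟨x, y, hxy⟩
    exact ⟨fun _ _ => x, fun _ _ => y, by linear_combination -hxy, by linear_combination -hxy⟩

/-- In a local ring, two elements are comaximal iff one of them is a unit. -/
theorem IsLocalRing.isCoprime_iff_isUnit_or_isUnit {S : Type*} [CommRing S] [IsLocalRing S]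
    (a b : S) : IsCoprime a b ↔ IsUnit a ∨ IsUnit b := by
  constructor
  · rintro ⟨x, y, hxy⟩
    exact (IsLocalRing.isUnit_or_isUnit_of_add_one hxy).imp
      isUnit_of_mul_isUnit_right isUnit_of_mul_isUnit_right
  · rintro (h | h)
    · exact isCoprime_one_left.of_isCoprime_of_dvd_left h.dvd
    · exact isCoprime_one_right.of_isCoprime_of_dvd_right h.dvd

theorem stmt14 (R : Type) [CommRing R] (f0 f1 : R) :
    ∀ p : PrimeSpectrum R,
      (p ∈ (koszulMF R f1 f0).Supp ↔ f0 ∈ p.asIdeal ∧ f1 ∈ p.asIdeal) := by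
  intro p
  change ¬ (koszulMF (Localization.AtPrime p.asIdeal) (algebraMap R _ f1)
    (algebraMap R _ f0)).Contractible ↔ _
  rw [koszulMF_contractible_iff, IsLocalRing.isCoprime_iff_isUnit_or_isUnit,
    IsLocalization.AtPrime.isUnit_to_map_iff _ p.asIdeal,
    IsLocalization.AtPrime.isUnit_to_map_iff _ p.asIdeal]
  simp only [Ideal.mem_primeCompl_iff, not_or, not_not]
  exact and_comm
end

section
/- Let R be a commutative ring, w ∈ R, and F a matrix factorization of w over R. Then the support Supp(F) = { p ∈ Spec R : F_p is not contractible } is a Zariski-closed subset of Spec R. -/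
open Matrix

namespace Matrix

/-- Finitely many entries over a localization have a common denominator. -/
theorem exists_smul_eq_map_algebraMap {R K m n : Type*} [CommRing R] [CommRing K] [Algebra R K]
    [Finite m] [Finite n] (M : Submonoid R) [IsLocalization M K] (P : Matrix m n K) :
    ∃ s ∈ M, ∃ Q : Matrix m n R, algebraMap R K s • P = Q.map (algebraMap R K) := by
  obtain ⟨s, hs⟩ := IsLocalization.exist_integer_multiples_of_finite M
    (fun ij : m × n => P ij.1 ij.2)
  choose Q hQ using hs
  refine ⟨s, s.2, of fun i j => Q (i, j), ?_⟩
  ext i j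
  simpa [Algebra.smul_def] using (hQ (i, j)).symm

/-- Matrices that agree over a localization agree up to a common factor in the submonoid. -/
theorem exists_smul_eq_smul_of_map_algebraMap_eq {R K m n : Type*} [CommRing R] [CommRing K]
    [Algebra R K] [Fintype m] [Fintype n] (M : Submonoid R) [IsLocalization M K]
    {P Q : Matrix m n R} (h : P.map (algebraMap R K) = Q.map (algebraMap R K)) :
    ∃ t ∈ M, t • P = t • Q := by
  have hentry : ∀ ij : m × n, ∃ c : M, c * P ij.1 ij.2 = c * Q ij.1 ij.2 := fun ij =>
    IsLocalization.exists_of_eq (S := K) (congrFun (congrFun h ij.1) ij.2)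
  choose c hc using hentry
  refine ⟨∏ ij, (c ij : R), M.prod_mem fun ij _ => (c ij).2, ?_⟩
  ext i j
  obtain ⟨d, hd⟩ := Finset.dvd_prod_of_mem (fun ij => (c ij : R)) (Finset.mem_univ (i, j))
  have := hc (i, j)
  simp only [smul_apply, smul_eq_mul]
  rw [hd]
  linear_combination d * this

end Matrix

namespace MF

/-- The scalar `r` annihilates the identity of `F` up to homotopy. -/
def ScalarNullHomotopic {R : Type} [CommRing R] (F : MF R) (r : R) : Prop :=
  ∃ (h0 : Matrix F.ι1 F.ι0 R) (h1 : Matrix F.ι0 F.ι1 R),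
    r • (1 : Matrix F.ι0 F.ι0 R) = F.A * h0 + h1 * F.B ∧
    r • (1 : Matrix F.ι1 F.ι1 R) = F.B * h1 + h0 * F.A

theorem ScalarNullHomotopic.mul_left {R : Type} [CommRing R] {F : MF R} {r : R}
    (h : F.ScalarNullHomotopic r) (c : R) : F.ScalarNullHomotopic (c * r) := by
  obtain ⟨h0, h1, e0, e1⟩ := h
  exact ⟨c • h0, c • h1, by simp [mul_smul, e0], by simp [mul_smul, e1]⟩

theorem ScalarNullHomotopic.map {R S : Type} [CommRing R] [CommRing S] {F : MF R} {r : R}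
    (h : F.ScalarNullHomotopic r) (f : R →+* S) : (F.map f).ScalarNullHomotopic (f r) := by
  obtain ⟨h0, h1, e0, e1⟩ := h
  refine ⟨h0.map f, h1.map f, ?_, ?_⟩
  · change f r • (1 : Matrix F.ι0 F.ι0 S) = F.A.map f * h0.map f + h1.map f * F.B.map f
    simpa [Matrix.map_add, Matrix.map_mul, Matrix.map_smul'] using
      congrArg (fun X => X.map f) e0
  · change f r • (1 : Matrix F.ι1 F.ι1 S) = F.B.map f * h1.map f + h0.map f * F.A.map f
    simpa [Matrix.map_add, Matrix.map_mul, Matrix.map_smul'] using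
      congrArg (fun X => X.map f) e1

theorem scalarNullHomotopic_one {R : Type} [CommRing R] {F : MF R} :
    F.ScalarNullHomotopic 1 ↔ F.Contractible := by
  simp [ScalarNullHomotopic, Contractible]

theorem contractible_map_iff {R K : Type} [CommRing R] [CommRing K] [Algebra R K]
    (M : Submonoid R) [IsLocalization M K] (F : MF R) :
    (F.map (algebraMap R K)).Contractible ↔ ∃ r ∈ M, F.ScalarNullHomotopic r := by
  constructor
  · rintro ⟨(h0 : Matrix F.ι1 F.ι0 K), (h1 : Matrix F.ι0 F.ι1 K), e0, e1⟩
    change (1 : Matrix F.ι0 F.ι0 K) =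
      F.A.map (algebraMap R K) * h0 + h1 * F.B.map (algebraMap R K) at e0
    change (1 : Matrix F.ι1 F.ι1 K) =
      F.B.map (algebraMap R K) * h1 + h0 * F.A.map (algebraMap R K) at e1
    obtain ⟨s, hs, g0, hg0⟩ := Matrix.exists_smul_eq_map_algebraMap M h0
    obtain ⟨t, ht, g1, hg1⟩ := Matrix.exists_smul_eq_map_algebraMap M h1
    have p0 : (t • g0).map (algebraMap R K) = algebraMap R K (s * t) • h0 := by
      rw [mul_comm, map_mul, mul_smul, hg0]
      ext
      simp
    have p1 : (s • g1).map (algebraMap R K) = algebraMap R K (s * t) • h1 := by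
      rw [map_mul, mul_smul, hg1]
      ext
      simp
    have d0 : ((s * t) • (1 : Matrix F.ι0 F.ι0 R)).map (algebraMap R K) =
        (F.A * (t • g0) + (s • g1) * F.B).map (algebraMap R K) := by
      simp only [Matrix.map_smul' _ _ _ (map_mul _), Matrix.map_add _ (map_add _),
        Matrix.map_mul, Matrix.map_one _ (map_zero _) (map_one _), p0, p1]
      rw [e0]
      simp
    have d1 : ((s * t) • (1 : Matrix F.ι1 F.ι1 R)).map (algebraMap R K) =
        (F.B * (s • g1) + (t • g0) * F.A).map (algebraMap R K) := by
      simp only [Matrix.map_smul' _ _ _ (map_mul _), Matrix.map_add _ (map_add _),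
        Matrix.map_mul, Matrix.map_one _ (map_zero _) (map_one _), p0, p1]
      rw [e1]
      simp
    obtain ⟨u, hu, k0⟩ := Matrix.exists_smul_eq_smul_of_map_algebraMap_eq M d0
    obtain ⟨v, hv, k1⟩ := Matrix.exists_smul_eq_smul_of_map_algebraMap_eq M d1
    refine ⟨u * v * (s * t), M.mul_mem (M.mul_mem hu hv) (M.mul_mem hs ht),
      (u * v) • t • g0, (u * v) • s • g1, ?_, ?_⟩
    · rw [mul_comm u v, mul_smul, mul_smul, k0]
      simp [mul_smul]
    · rw [mul_smul, mul_smul, k1]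
      simp [mul_smul]
  · rintro ⟨r, hr, h⟩
    obtain ⟨c, hc⟩ := (IsLocalization.map_units K ⟨r, hr⟩).exists_left_inv
    have := (h.map (algebraMap R K)).mul_left c
    rwa [hc, scalarNullHomotopic_one] at this

theorem supp_eq_zeroLocus {R : Type} [CommRing R] (F : MF R) :
    F.Supp = PrimeSpectrum.zeroLocus {r | F.ScalarNullHomotopic r} := by
  ext p
  simp only [Supp, Set.mem_ofPred_eq, contractible_map_iff p.asIdeal.primeCompl,
    PrimeSpectrum.mem_zeroLocus, Set.subset_def, Ideal.mem_primeCompl_iff, SetLike.mem_coe]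
  grind

end MF

theorem stmt17 (R : Type) [CommRing R] (w : R) (F : MF R) (hF : F.IsMF w) :
    IsClosed F.Supp := by
  rw [F.supp_eq_zeroLocus]
  exact PrimeSpectrum.isClosed_zeroLocus _
end
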